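/- For any biconed graph G^{A,B}, the h-vector of the graphic matroid of G^{A,B} is a pure O-sequence. -/

import Mathlib

/-!
Formalization scaffold for "h-vectors of graphic matroids of biconed graphs".

A graph `G` (loops and parallel edges allowed) with vertex set `A ∪ B` is
modelled by an abstract finite edge type `E` with an endpoint map
`ends : E → Sym2 (Fin m ⊕ₗ Fin n)`, where `A = Fin m = {1,…,m}`,
`Ā = B \ A = Fin n = {1̄,…,n̄}` and the finset `S ⊆ Fin m` records `A ∩ B`
(so `B = S ∪ Ā`).  The biconing `G^{A,B}` adds the two vertices `0` and `0̄`
and the edges `00̄`, `0a (a ∈ A)` and `0̄b (b ∈ B)`.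
-/

namespace BiconedPaper

noncomputable section
open scoped Classical

/-! ### Walks in multigraphs presented by an endpoint map -/

/-- A walk in the multigraph with edge set `ε` and endpoint map `ends`. -/
inductive MWalk {ε ν : Type} (ends : ε → Sym2 ν) : ν → ν → Type
  | nil (u : ν) : MWalk ends u u
  | cons {u w : ν} (e : ε) (v : ν) (h : ends e = s(u, v)) (p : MWalk ends v w) :
      MWalk ends u w

namespace MWalk

variable {ε ν : Type} {ends : ε → Sym2 ν}

/-- The list of edges traversed by a walk. -/
def edges : ∀ {u v : ν}, MWalk ends u v → List ε
  | _, _, nil _ => []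
  | _, _, cons e _ _ p => e :: p.edges

/-- The list of vertices visited by a walk. -/
def support : ∀ {u v : ν}, MWalk ends u v → List ν
  | u, _, nil _ => [u]
  | u, _, cons _ _ _ p => u :: p.support

/-- A walk is a path if it visits no vertex twice. -/
def IsPath {u v : ν} (p : MWalk ends u v) : Prop := p.support.Nodup

/-- All edges of the walk belong to the edge set `F`. -/
def edgesIn {u v : ν} (p : MWalk ends u v) (F : Finset ε) : Prop :=
  ∀ e ∈ p.edges, e ∈ F

/-- The number of "bridging" edges traversed by a walk, i.e. steps whose two
endpoints lie on different sides according to `sideF`. -/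
def bridgeCount (sideF : ν → Bool) : ∀ {u v : ν}, MWalk ends u v → ℕ
  | _, _, nil _ => 0
  | u, _, cons _ v' _ p => (if sideF u = sideF v' then 0 else 1) + p.bridgeCount sideF

end MWalk

/-- `u` and `v` are joined by a walk all of whose edges lie in `F`. -/
def Reachable {ε ν : Type} (ends : ε → Sym2 ν) (F : Finset ε) (u v : ν) : Prop :=
  ∃ p : MWalk ends u v, p.edgesIn F

/-- An edge set is acyclic (a forest) iff removing any one of its edges
disconnects the endpoints of that edge.  (In particular no loops and no
parallel pairs.) -/
def IsAcyclic {ε ν : Type} [DecidableEq ε] (ends : ε → Sym2 ν) (F : Finset ε) : Prop :=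
  ∀ e ∈ F, ∀ u v : ν, ends e = s(u, v) → ¬ Reachable ends (F.erase e) u v

/-- A spanning tree: an acyclic edge set connecting every pair of vertices. -/
def IsSpanningTree {ε ν : Type} [DecidableEq ε] (ends : ε → Sym2 ν) (T : Finset ε) : Prop :=
  IsAcyclic ends T ∧ ∀ u v : ν, Reachable ends T u v

/-! ### Biconed graphs -/

/-- The data of a biconed graph `G^{A,B}`:  the graph `G` has vertex set
`A ∪ B` with `A = Fin m`, `Ā = B \ A = Fin n`, `A ∩ B = S`, and abstract
edge set `E` (so loops and parallel edges are allowed). -/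
structure BiconedGraph where
  m : ℕ
  n : ℕ
  E : Type
  fintypeE : Fintype E
  decEqE : DecidableEq E
  ends : E → Sym2 (Fin m ⊕ₗ Fin n)
  S : Finset (Fin m)

namespace BiconedGraph

variable (P : BiconedGraph)

instance : Fintype P.E := P.fintypeE
instance : DecidableEq P.E := P.decEqE

/-- The vertices of `G`, linearly ordered `1 < ⋯ < m < 1̄ < ⋯ < n̄`. -/
abbrev VG := Fin P.m ⊕ₗ Fin P.n

/-- The vertices of `G^{A,B}_red`:  `⊥` is the vertex `0̄`, ordered
`0̄ < 1 < ⋯ < m < 1̄ < ⋯ < n̄`. -/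
abbrev Vred := WithBot P.VG

/-- The vertices of `G^{A,B}`: `⊥` is `0`, ordered `0 < 0̄ < 1 < ⋯ < n̄`. -/
abbrev W := WithBot P.Vred

/-- The vertex `a ∈ A`. -/
def aVert (a : Fin P.m) : P.VG := toLex (Sum.inl a)
/-- The vertex `b ∈ Ā`. -/
def bVert (b : Fin P.n) : P.VG := toLex (Sum.inr b)
/-- Inclusion of the vertices of `G` into those of `G^{A,B}_red`. -/
def liftV (x : P.VG) : P.Vred := (x : WithBot P.VG)
/-- Inclusion of the vertices of `G^{A,B}_red` into those of `G^{A,B}`. -/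
def liftW (x : P.Vred) : P.W := (x : WithBot P.Vred)

/-- The edges of the biconed graph `G^{A,B}`:  the edge `00̄`, the coning
edges `0a (a ∈ A)`, `0̄b (b ∈ Ā)`, `0̄a (a ∈ A ∩ B)`, and the edges of `G`. -/
abbrev EB := Unit ⊕ (Fin P.m ⊕ (Fin P.n ⊕ ({a : Fin P.m // a ∈ P.S} ⊕ P.E)))

/-- The edge `00̄`. -/
abbrev e00 : P.EB := Sum.inl ()
/-- The coning edge `0a`, `a ∈ A`. -/
abbrev eA (a : Fin P.m) : P.EB := Sum.inr (Sum.inl a)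
/-- The coning edge `0̄b`, `b ∈ Ā`. -/
abbrev eB (b : Fin P.n) : P.EB := Sum.inr (Sum.inr (Sum.inl b))
/-- The coning edge `0̄a`, `a ∈ A ∩ B`. -/
abbrev eS (a : {a : Fin P.m // a ∈ P.S}) : P.EB := Sum.inr (Sum.inr (Sum.inr (Sum.inl a)))
/-- An original edge of `G`. -/
abbrev eG (e : P.E) : P.EB := Sum.inr (Sum.inr (Sum.inr (Sum.inr e)))

/-- The endpoint map of `G^{A,B}`. -/
def endsB : P.EB → Sym2 P.W
  | Sum.inl _ => s((⊥ : P.W), P.liftW ⊥)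
  | Sum.inr (Sum.inl a) => s((⊥ : P.W), P.liftW (P.liftV (P.aVert a)))
  | Sum.inr (Sum.inr (Sum.inl b)) => s(P.liftW ⊥, P.liftW (P.liftV (P.bVert b)))
  | Sum.inr (Sum.inr (Sum.inr (Sum.inl a))) => s(P.liftW ⊥, P.liftW (P.liftV (P.aVert a.1)))
  | Sum.inr (Sum.inr (Sum.inr (Sum.inr e))) => (P.ends e).map fun x => P.liftW (P.liftV x)

/-- The spanning tree `T₀`, consisting of `00̄`, the edges `0a (a ∈ A)` and
the edges `0̄b (b ∈ Ā)`. -/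
def T0 : Finset P.EB :=
  Finset.univ.filter fun e => match e with
    | Sum.inl _ => True
    | Sum.inr (Sum.inl _) => True
    | Sum.inr (Sum.inr (Sum.inl _)) => True
    | _ => False

/-- The edges of `G^{A,B}_red` (delete the edges of `T₀` and the vertex `0`):
the edges `0̄a (a ∈ A ∩ B)` together with the edges of `G`. -/
abbrev Ered := {a : Fin P.m // a ∈ P.S} ⊕ P.E

/-- The endpoint map of `G^{A,B}_red`; `⊥` is the vertex `0̄`. -/
def endsRed : P.Ered → Sym2 P.Vred
  | Sum.inl a => s((⊥ : P.Vred), P.liftV (P.aVert a.1))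
  | Sum.inr e => (P.ends e).map P.liftV

/-- Inclusion of the edges of `G^{A,B}_red` into those of `G^{A,B}`. -/
def redToEB : P.Ered → P.EB
  | Sum.inl a => P.eS a
  | Sum.inr e => P.eG e

/-- The edge set `T \ T₀` of `T`, viewed inside `G^{A,B}_red`. -/
def redOf (T : Finset P.EB) : Finset P.Ered :=
  Finset.univ.filter fun e => P.redToEB e ∈ T

/-- `true` on the vertices of `A`, `false` on the vertices of `Ā ∪ {0̄}`. -/
def side : P.Vred → Bool :=
  WithBot.recBotCoe false fun x => Sum.elim (fun _ => true) (fun _ => false) (ofLex x)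

/-- The vertex lies in `A`. -/
def InA (v : P.Vred) : Prop := ∃ a : Fin P.m, v = P.liftV (P.aVert a)

/-- An edge of `G^{A,B}_red` is bridging if it joins a vertex of `A` to a
vertex of `Ā ∪ {0̄}`. -/
def BridgingE (e : P.Ered) : Prop :=
  ∃ u v : P.Vred, P.endsRed e = s(u, v) ∧ P.side u ≠ P.side v

/-! ### 2-edge-rooted forests -/

/-- The underlying edge set `F` of the multiset of edges given by the
multiplicity function `mult` (an edge `e` carries `mult e - 1` edge roots). -/
def mSupport (mult : P.Ered → ℕ) : Finset P.Ered :=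
  Finset.univ.filter fun e => mult e ≠ 0

/-- The degree of the multiset of edges given by `mult`. -/
def deg (mult : P.Ered → ℕ) : ℕ := ∑ e : P.Ered, mult e

/-- Edge `e` meets the connected component of `v` in the edge set `F`. -/
def Touches (F : Finset P.Ered) (v : P.Vred) (e : P.Ered) : Prop :=
  ∃ u : P.Vred, u ∈ P.endsRed e ∧ Reachable P.endsRed F v u

/-- The total number of edge roots in the component of `v`. -/
def compEdgeRoots (mult : P.Ered → ℕ) (v : P.Vred) : ℕ :=
  ∑ e ∈ P.mSupport mult, if P.Touches (P.mSupport mult) v e then mult e - 1 else 0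

/-- The component of `v` is `compCount`-edge-rooted:  the number of its edge
roots, plus `1` if it contains the vertex `0̄`. -/
def compCount (mult : P.Ered → ℕ) (v : P.Vred) : ℕ :=
  P.compEdgeRoots mult v +
    if Reachable P.endsRed (P.mSupport mult) v (⊥ : P.Vred) then 1 else 0

/-- Condition (C3) for the `2`-edge-rooted component of `v`:  the unique
shortest path containing both edge roots (resp. the vertex `0̄` and the edge
root, if the component contains `0̄`) has an odd number of bridging edges.
The shortest path containing two edges is the unique path whose first and
last edges are the two rooted edges; if the two edge roots lie on one common
edge (`mult e = 3`) the path is that single edge. -/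
def C3At (mult : P.Ered → ℕ) (v : P.Vred) : Prop :=
  (Reachable P.endsRed (P.mSupport mult) v (⊥ : P.Vred) →
    ∃ (x : P.Vred) (p : MWalk P.endsRed (⊥ : P.Vred) x),
      p.IsPath ∧ p.edgesIn (P.mSupport mult) ∧
      (∃ e, p.edges.getLast? = some e ∧ 2 ≤ mult e) ∧
      Odd (p.bridgeCount P.side)) ∧
  (¬ Reachable P.endsRed (P.mSupport mult) v (⊥ : P.Vred) →
    ∃ (x y : P.Vred) (p : MWalk P.endsRed x y),
      p.IsPath ∧ p.edgesIn (P.mSupport mult) ∧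
      Reachable P.endsRed (P.mSupport mult) v x ∧
      (∃ e, p.edges.head? = some e ∧ 2 ≤ mult e) ∧
      (∃ e, p.edges.getLast? = some e ∧ 2 ≤ mult e) ∧
      (∀ e, p.edges = [e] → mult e = 3) ∧
      Odd (p.bridgeCount P.side))

/-- `mult : Ered → ℕ` is (the multiplicity function of) a 2-edge-rooted
forest of `G^{A,B}_red`:
(C0) its support is a spanning forest;
(C1) at most one component is `2`-edge-rooted;
(C2) every other component is `0`- or `1`-edge-rooted;
(C3) the parity condition on the path joining the two roots. -/
def Is2ERF (mult : P.Ered → ℕ) : Prop :=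
  IsAcyclic P.endsRed (P.mSupport mult) ∧
  (∀ v : P.Vred, P.compCount mult v ≤ 2) ∧
  (∀ u v : P.Vred, P.compCount mult u = 2 → P.compCount mult v = 2 →
    Reachable P.endsRed (P.mSupport mult) u v) ∧
  (∀ v : P.Vred, P.compCount mult v = 2 → P.C3At mult v)

/-! ### Birooted forests -/

/-- `(F, R)` is a birooted forest of `G^{A,B}_red`:  `F` is a spanning forest,
the root set `R` contains `0̄`, every component of `F` contains at least one
root, no component contains three roots, at most one component contains two
roots, and a component with two roots has one root in `A` and the other in
`Ā ∪ {0̄}`. -/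
def IsBirootedForest (F : Finset P.Ered) (R : Set P.Vred) : Prop :=
  IsAcyclic P.endsRed F ∧
  (⊥ : P.Vred) ∈ R ∧
  (∀ v : P.Vred, ∃ r ∈ R, Reachable P.endsRed F v r) ∧
  (∀ r₁ ∈ R, ∀ r₂ ∈ R, ∀ r₃ ∈ R, r₁ ≠ r₂ → r₁ ≠ r₃ → r₂ ≠ r₃ →
    Reachable P.endsRed F r₁ r₂ → Reachable P.endsRed F r₁ r₃ → False) ∧
  (∀ r₁ ∈ R, ∀ r₂ ∈ R, ∀ r₃ ∈ R, ∀ r₄ ∈ R, r₁ ≠ r₂ → r₃ ≠ r₄ →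
    Reachable P.endsRed F r₁ r₂ → Reachable P.endsRed F r₃ r₄ →
    Reachable P.endsRed F r₁ r₃) ∧
  (∀ r₁ ∈ R, ∀ r₂ ∈ R, r₁ ≠ r₂ → Reachable P.endsRed F r₁ r₂ →
    (P.InA r₁ ∧ ¬ P.InA r₂) ∨ (P.InA r₂ ∧ ¬ P.InA r₁))

/-! ### Internal activity and the edge order -/

/-- `e` is internally passive in the spanning tree `T`:  it can be exchanged
for a strictly smaller edge `f` so that the result is again a spanning tree. -/
def InternallyPassive (ord : LinearOrder P.EB) (T : Finset P.EB) (e : P.EB) : Prop :=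
  e ∈ T ∧ ∃ f : P.EB, ord.lt f e ∧ IsSpanningTree P.endsB (insert f (T.erase e))

/-- `e` is internally active in the spanning tree `T`. -/
def InternallyActive (ord : LinearOrder P.EB) (T : Finset P.EB) (e : P.EB) : Prop :=
  e ∈ T ∧ ¬ ∃ f : P.EB, ord.lt f e ∧ IsSpanningTree P.endsB (insert f (T.erase e))

/-- The number of internally passive edges of `T`. -/
def ipCount (ord : LinearOrder P.EB) (T : Finset P.EB) : ℕ :=
  (T.filter fun e => P.InternallyPassive ord T e).card

/-- The smaller endpoint of an edge of `G^{A,B}`. -/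
def endMin (e : P.EB) : P.W := Sym2.lift ⟨fun a b => a ⊓ b, fun a b => inf_comm a b⟩ (P.endsB e)
/-- The larger endpoint of an edge of `G^{A,B}`. -/
def endMax (e : P.EB) : P.W := Sym2.lift ⟨fun a b => a ⊔ b, fun a b => sup_comm a b⟩ (P.endsB e)

/-- The endpoints of an edge, as an ordered pair in the lexicographic square
of the vertex order `0 < 0̄ < 1 < ⋯ < m < 1̄ < ⋯ < n̄`. -/
def lexEnds (e : P.EB) : P.W ×ₗ P.W := toLex (P.endMin e, P.endMax e)

/-- A linear order on the edges of `G^{A,B}` is admissible if it refines the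
lexicographic order on endpoints (so parallel edges are ordered arbitrarily). -/
def AdmissibleOrder (ord : LinearOrder P.EB) : Prop :=
  ∀ e f : P.EB, P.lexEnds e < P.lexEnds f → ord.lt e f

/-- `v` is a connecting vertex of `T`:  `v ∈ A` and `v` is adjacent to `0` in
`T`, or `v ∈ Ā` and `v` is adjacent to `0̄` in `T`. -/
def ConnVertex (T : Finset P.EB) (v : P.Vred) : Prop :=
  (∃ a : Fin P.m, v = P.liftV (P.aVert a) ∧ P.eA a ∈ T) ∨
  (∃ b : Fin P.n, v = P.liftV (P.bVert b) ∧ P.eB b ∈ T)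

/-- `e` is a connecting edge of `T` (an edge `0a`, `a ∈ A`, or `0̄b`, `b ∈ Ā`)
with connecting vertex `v`. -/
def ConnEdge (T : Finset P.EB) (e : P.EB) (v : P.Vred) : Prop :=
  e ∈ T ∧ ((∃ a : Fin P.m, e = P.eA a ∧ v = P.liftV (P.aVert a)) ∨
           (∃ b : Fin P.n, e = P.eB b ∧ v = P.liftV (P.bVert b)))

/-! ### The h-vector -/

/-- `f_{i-1}`:  the number of acyclic edge sets of cardinality `i` in `G^{A,B}`. -/
def numAcyclic (i : ℕ) : ℕ :=
  Nat.card {F : Finset P.EB // IsAcyclic P.endsB F ∧ F.card = i}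

/-- The rank of the graphic matroid of `G^{A,B}`:  `|V| - 1 = m + n + 1`. -/
def d : ℕ := P.m + P.n + 1

/-- `h` is the h-vector of the graphic matroid of `G^{A,B}`:  it satisfies
`Σ_{i=0}^{d} f_{i-1} (t-1)^{d-i} = Σ_{k=0}^{d} h_k t^{d-k}`. -/
def IsHVector (h : ℕ → ℤ) : Prop :=
  ∑ i ∈ Finset.range (P.d + 1),
      Polynomial.C ((P.numAcyclic i : ℤ)) * (Polynomial.X - 1) ^ (P.d - i)
    = ∑ k ∈ Finset.range (P.d + 1), Polynomial.C (h k) * Polynomial.X ^ (P.d - k)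

end BiconedGraph

/-- `(h 0, …, h d)` is a pure O-sequence:  there is a multicomplex `M` of
multisets on a finite ground set (nonempty, closed under sub-multisets), all
of whose inclusion-maximal members have the same cardinality, whose members
all have cardinality at most `d`, and which has exactly `h i` members of
cardinality `i` for every `i ≤ d`. -/
def IsPureOSeq (d : ℕ) (h : ℕ → ℤ) : Prop :=
  ∃ (N : ℕ) (M : Set (Multiset (Fin N))),
    M.Nonempty ∧
    (∀ s ∈ M, ∀ t : Multiset (Fin N), t ≤ s → t ∈ M) ∧
    (∀ s ∈ M, ∀ t ∈ M, (∀ u ∈ M, s ≤ u → u = s) → (∀ u ∈ M, t ≤ u → u = t) →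
      Multiset.card s = Multiset.card t) ∧
    (∀ s ∈ M, Multiset.card s ≤ d) ∧
    (∀ i ≤ d, (Nat.card {s : Multiset (Fin N) // s ∈ M ∧ Multiset.card s = i} : ℤ) = h i)


set_option linter.unusedSectionVars false

section Basics
variable {ε ν : Type} {ends : ε → Sym2 ν}

/-- Reachability is reflexive. -/
theorem Reachable.refl (F : Finset ε) (u : ν) : Reachable ends F u u :=
  ⟨MWalk.nil u, by intro e he; simp [MWalk.edges] at he⟩

theorem Reachable.head {F : Finset ε} {u v w : ν} {e : ε} (he : e ∈ F)
    (h : ends e = s(u, v)) (hr : Reachable ends F v w) : Reachable ends F u w := by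
  obtain ⟨p, hp⟩ := hr
  refine ⟨MWalk.cons e v h p, ?_⟩
  intro f hf
  simp only [MWalk.edges, List.mem_cons] at hf
  rcases hf with rfl | hf
  · exact he
  · exact hp f hf

theorem Reachable.edge {F : Finset ε} {u v : ν} {e : ε} (he : e ∈ F)
    (h : ends e = s(u, v)) : Reachable ends F u v :=
  Reachable.head he h (Reachable.refl F v)

/-- Induction principle for reachability. -/
theorem Reachable.ind {F : Finset ε} {w : ν} {motive : ν → Prop}
    (hnil : motive w)
    (hcons : ∀ u v e, e ∈ F → ends e = s(u, v) → Reachable ends F v w → motive v → motive u)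
    {u : ν} (h : Reachable ends F u w) : motive u := by
  obtain ⟨p, hp⟩ := h
  induction p with
  | nil u => exact hnil
  | cons e v h p ih =>
    have hp' : p.edgesIn F := fun f hf => hp f (by simp [MWalk.edges, hf])
    exact hcons _ v e (hp e (by simp [MWalk.edges])) h ⟨p, hp'⟩ (ih hnil hcons hp')

theorem Reachable.trans {F : Finset ε} {u v w : ν} (h : Reachable ends F u v)
    (h' : Reachable ends F v w) : Reachable ends F u w :=
  Reachable.ind (motive := fun u => Reachable ends F u w) h'
    (fun _ _ _ he hh _ ih => Reachable.head he hh ih) h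

theorem Reachable.symm {F : Finset ε} {u v : ν} (h : Reachable ends F u v) :
    Reachable ends F v u :=
  Reachable.ind (motive := fun u => Reachable ends F v u) (Reachable.refl F v)
    (fun _ _ _ he hh _ ih => ih.trans (Reachable.edge he (by rw [hh, Sym2.eq_swap]))) h

theorem Reachable.mono {F F' : Finset ε} (hF : F ⊆ F') {u v : ν} (h : Reachable ends F u v) :
    Reachable ends F' u v :=
  Reachable.ind (motive := fun u => Reachable ends F' u v) (Reachable.refl F' v)
    (fun _ _ _ he hh _ ih => Reachable.head (hF he) hh ih) h

theorem reachable_empty {u v : ν} : Reachable ends ∅ u v ↔ u = v := by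
  constructor
  · intro h
    exact Reachable.ind (motive := fun u => u = v) rfl
      (fun _ _ _ he _ _ _ => absurd he (Finset.notMem_empty _)) h
  · rintro rfl
    exact Reachable.refl _ _

theorem Reachable.of_mem {F : Finset ε} {u v : ν} {e : ε} (he : e ∈ F)
    (hu : u ∈ ends e) (hv : v ∈ ends e) : Reachable ends F u v := by
  obtain ⟨w, hw⟩ := Sym2.mem_iff_exists.1 hu
  rw [hw] at hv
  rcases Sym2.mem_iff.1 hv with rfl | rfl
  · exact Reachable.refl _ _
  · exact Reachable.edge he hw

/-- A chosen endpoint of an edge. -/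
def ec (ends : ε → Sym2 ν) (e : ε) : ν := (Quot.out (ends e)).1

theorem ec_mem (e : ε) : ec ends e ∈ ends e := Sym2.out_fst_mem _

theorem ec_reach {F : Finset ε} {e : ε} (he : e ∈ F) {u : ν} (hu : u ∈ ends e) :
    Reachable ends F (ec ends e) u := Reachable.of_mem he (ec_mem e) hu

variable [DecidableEq ε]

/-- The fundamental description of reachability after adding an edge. -/
theorem reachable_insert {F : Finset ε} {e : ε} {u v : ν} (he : ends e = s(u, v)) {x y : ν} :
    Reachable ends (insert e F) x y ↔ Reachable ends F x y ∨
      (Reachable ends F x u ∧ Reachable ends F v y) ∨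
      (Reachable ends F x v ∧ Reachable ends F u y) := by
  constructor
  · intro h
    refine Reachable.ind (motive := fun x => Reachable ends F x y ∨
      (Reachable ends F x u ∧ Reachable ends F v y) ∨
      (Reachable ends F x v ∧ Reachable ends F u y)) (Or.inl (Reachable.refl _ _)) ?_ h
    intro a b f hf hab _ ih
    rcases Finset.mem_insert.1 hf with rfl | hf
    · rw [he] at hab
      rcases Sym2.eq_iff.1 hab with ⟨rfl, rfl⟩ | ⟨rfl, rfl⟩
      · rcases ih with ih | ⟨h1, h2⟩ | ⟨h1, h2⟩
        · exact Or.inr (Or.inl ⟨Reachable.refl _ _, ih⟩)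
        · exact Or.inr (Or.inl ⟨Reachable.refl _ _, h2⟩)
        · exact Or.inl h2
      · rcases ih with ih | ⟨h1, h2⟩ | ⟨h1, h2⟩
        · exact Or.inr (Or.inr ⟨Reachable.refl _ _, ih⟩)
        · exact Or.inl h2
        · exact Or.inr (Or.inr ⟨Reachable.refl _ _, h2⟩)
    · rcases ih with ih | ⟨h1, h2⟩ | ⟨h1, h2⟩
      · exact Or.inl (Reachable.head hf hab ih)
      · exact Or.inr (Or.inl ⟨Reachable.head hf hab h1, h2⟩)
      · exact Or.inr (Or.inr ⟨Reachable.head hf hab h1, h2⟩)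
  · have hsub : F ⊆ insert e F := Finset.subset_insert _ _
    have hE : Reachable ends (insert e F) u v := Reachable.edge (Finset.mem_insert_self _ _) he
    rintro (h | ⟨h1, h2⟩ | ⟨h1, h2⟩)
    · exact h.mono hsub
    · exact (h1.mono hsub).trans (hE.trans (h2.mono hsub))
    · exact (h1.mono hsub).trans (hE.symm.trans (h2.mono hsub))

theorem reachable_erase {F : Finset ε} {e : ε} (heF : e ∈ F) {u v : ν} (he : ends e = s(u, v))
    {x y : ν} :
    Reachable ends F x y ↔ Reachable ends (F.erase e) x y ∨
      (Reachable ends (F.erase e) x u ∧ Reachable ends (F.erase e) v y) ∨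
      (Reachable ends (F.erase e) x v ∧ Reachable ends (F.erase e) u y) := by
  conv_lhs => rw [← Finset.insert_erase heF]
  exact reachable_insert he

theorem Reachable.split {F : Finset ε} {e : ε} (heF : e ∈ F) {u v : ν} (he : ends e = s(u, v))
    {x : ν} (h : Reachable ends F x u) :
    Reachable ends (F.erase e) x u ∨ Reachable ends (F.erase e) x v := by
  rcases (reachable_erase heF he).1 h with h | ⟨h, _⟩ | ⟨h, _⟩
  · exact Or.inl h
  · exact Or.inl h
  · exact Or.inr h

theorem IsAcyclic.mono {F F' : Finset ε} (h : IsAcyclic ends F') (hF : F ⊆ F') :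
    IsAcyclic ends F := by
  intro e he u v huv hr
  exact h e (hF he) u v huv (hr.mono (Finset.erase_subset_erase _ hF))

theorem IsAcyclic.insert_edge {F : Finset ε} (h : IsAcyclic ends F) {e : ε} {u v : ν}
    (he : ends e = s(u, v)) (hn : ¬ Reachable ends F u v) : IsAcyclic ends (insert e F) := by
  intro f hf x y hxy hr
  by_cases hfe : f = e
  · subst hfe
    have hr' := hr.mono (Finset.erase_insert_subset f F)
    rw [he] at hxy
    rcases Sym2.eq_iff.1 hxy with ⟨rfl, rfl⟩ | ⟨rfl, rfl⟩
    · exact hn hr'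
    · exact hn hr'.symm
  · have hfF : f ∈ F := Finset.mem_of_mem_insert_of_ne hf hfe
    rw [Finset.erase_insert_of_ne (Ne.symm hfe)] at hr
    have hsub := Finset.erase_subset f F
    have hfr : Reachable ends F x y := Reachable.edge hfF hxy
    rcases (reachable_insert he).1 hr with h1 | ⟨h1, h2⟩ | ⟨h1, h2⟩
    · exact h f hfF x y hxy h1
    · exact hn ((h1.mono hsub).symm.trans (hfr.trans (h2.mono hsub).symm))
    · exact hn ((h2.mono hsub).trans (hfr.symm.trans (h1.mono hsub)))

theorem IsAcyclic.not_reachable {F : Finset ε} {e : ε} (h : IsAcyclic ends (insert e F))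
    (heF : e ∉ F) {u v : ν} (he : ends e = s(u, v)) : ¬ Reachable ends F u v := by
  have := h e (Finset.mem_insert_self _ _) u v he
  rwa [Finset.erase_insert heF] at this

theorem isAcyclic_empty : IsAcyclic ends (∅ : Finset ε) := by
  intro e he; simp at he

/-- `e` is the first edge of the path from `u` to `v` in the forest `F`. -/
def First (ends : ε → Sym2 ν) (F : Finset ε) (u v : ν) (e : ε) : Prop :=
  e ∈ F ∧ u ∈ ends e ∧ Reachable ends F u v ∧ ¬ Reachable ends (F.erase e) u v

theorem First.exists {F : Finset ε} (hF : IsAcyclic ends F) {u v : ν} (h : Reachable ends F u v)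
    (hne : u ≠ v) : ∃ e, First ends F u v e := by
  obtain ⟨F0, hF0, hmin⟩ := (F.powerset.filter fun F' => Reachable ends F' u v).exists_minimal
    ⟨F, by simp [h]⟩
  simp only [Finset.mem_filter, Finset.mem_powerset] at hF0 hmin
  obtain ⟨hsub, hr⟩ := hF0
  obtain ⟨p, hp⟩ := hr
  cases p with
  | nil => exact absurd rfl hne
  | cons e w hw p =>
    have heF0 : e ∈ F0 := hp e (by simp [MWalk.edges])
    have hr : Reachable ends F0 u v := ⟨_, hp⟩
    have hn : ¬ Reachable ends (F0.erase e) u v := by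
      intro hcon
      have := hmin (y := F0.erase e) ⟨(Finset.erase_subset _ _).trans hsub, hcon⟩
        (Finset.erase_subset _ _)
      exact absurd (this heF0) (Finset.notMem_erase _ _)
    refine ⟨e, hsub heF0, by rw [hw]; simp, h, ?_⟩
    intro hcon
    have hvw : Reachable ends (F0.erase e) v w := by
      rcases Reachable.split heF0 hw hr.symm with h1 | h1
      · exact absurd h1.symm hn
      · exact h1
    exact hF e (hsub heF0) u w hw (hcon.trans (hvw.mono (Finset.erase_subset_erase _ hsub)))

theorem First.ne {F : Finset ε} {u v : ν} {e : ε} (h : First ends F u v e) : u ≠ v := by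
  rintro rfl
  exact h.2.2.2 (Reachable.refl _ _)

/-- The other endpoint of the first edge is joined to `v` without that edge. -/
theorem First.other {F : Finset ε} {u v : ν} {e : ε} (h : First ends F u v e) :
    ∃ w, ends e = s(u, w) ∧ Reachable ends (F.erase e) w v := by
  obtain ⟨w, hw⟩ := Sym2.mem_iff_exists.1 h.2.1
  refine ⟨w, hw, ?_⟩
  rcases Reachable.split h.1 hw h.2.2.1.symm with h1 | h1
  · exact absurd h1.symm h.2.2.2
  · exact h1.symm

theorem First.unique {F : Finset ε} (hF : IsAcyclic ends F) {u v : ν} {e f : ε}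
    (he : First ends F u v e) (hf : First ends F u v f) : e = f := by
  by_contra hne
  obtain ⟨w, hw, hwv⟩ := he.other
  obtain ⟨x, hx, hxv⟩ := hf.other
  have hfe : f ∈ F.erase e := Finset.mem_erase.2 ⟨Ne.symm hne, hf.1⟩
  have hef : e ∈ F.erase f := Finset.mem_erase.2 ⟨hne, he.1⟩
  rcases (reachable_erase hfe hx).1 hwv with h | ⟨h, _⟩ | ⟨_, h⟩
  · refine hf.2.2.2 ((Reachable.edge hef hw).trans (h.mono ?_))
    intro g hg
    simp only [Finset.mem_erase] at hg ⊢
    exact ⟨hg.1, hg.2.2⟩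
  · exact hF e he.1 u w hw (h.mono (Finset.erase_subset _ _)).symm
  · exact he.2.2.2 (h.mono (Finset.erase_subset _ _))

/-- Two different far ends of the same edge see different things. -/
theorem First.eq_of_same {F : Finset ε} {u u' v v' : ν} {e : ε}
    (h : First ends F u v e) (h' : First ends F u' v' e)
    (hv : Reachable ends (F.erase e) v v') : u = u' := by
  by_contra hne
  obtain ⟨w, hw, hwv⟩ := h.other
  have hu' := h'.2.1
  rw [hw] at hu'
  rcases Sym2.mem_iff.1 hu' with rfl | rfl
  · exact hne rfl
  · exact h'.2.2.2 (hwv.trans hv)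

/-- The pair of vertices is determined by the pair of end edges of the path between them,
once we know the sides of the vertices. -/
theorem First.pair_inj {F : Finset ε} {side : ν → Bool} {a b a' b' : ν} {e f e' f' : ε}
    (ha : side a = true) (hb : side b = false) (ha' : side a' = true) (hb' : side b' = false)
    (h1 : First ends F a b e) (h2 : First ends F b a f)
    (h1' : First ends F a' b' e') (h2' : First ends F b' a' f')
    (hef : (e = e' ∧ f = f') ∨ (e = f' ∧ f = e')) : a = a' ∧ b = b' := by
  have hab : a ≠ b' := by rintro rfl; simp [ha] at hb'
  have hab' : a' ≠ b := by rintro rfl; simp [ha'] at hb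
  by_cases hfe : f = e
  · subst hfe
    have he' : e' = f := by rcases hef with ⟨h, _⟩ | ⟨_, h⟩ <;> exact h.symm
    have hf' : f' = f := by rcases hef with ⟨_, h⟩ | ⟨h, _⟩ <;> exact h.symm
    subst he'
    subst hf'
    obtain ⟨w, hw⟩ := Sym2.mem_iff_exists.1 h1.2.1
    have m1 := h2.2.1
    have m2 := h1'.2.1
    have m3 := h2'.2.1
    rw [hw, Sym2.mem_iff] at m1 m2 m3
    have n1 := h1.ne
    have n2 := h1'.ne
    grind
  · rcases hef with ⟨rfl, rfl⟩ | ⟨rfl, rfl⟩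
    · constructor
      · refine First.eq_of_same h1 h1' (Reachable.of_mem (Finset.mem_erase.2 ⟨hfe, h2.1⟩) h2.2.1 h2'.2.1)
      · refine First.eq_of_same h2 h2'
          (Reachable.of_mem (Finset.mem_erase.2 ⟨Ne.symm hfe, h1.1⟩) h1.2.1 h1'.2.1)
    · exfalso
      exact hab (First.eq_of_same h1 h2'
        (Reachable.of_mem (Finset.mem_erase.2 ⟨hfe, h2.1⟩) h2.2.1 h1'.2.1))

theorem card_component [Fintype ν] {F : Finset ε} (hF : IsAcyclic ends F) (x : ν) :
    (Finset.univ.filter fun y => Reachable ends F y x).card =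
      (F.filter fun e => Reachable ends F (ec ends e) x).card + 1 := by
  induction F using Finset.induction_on generalizing x with
  | empty =>
    rw [Finset.filter_empty, Finset.card_empty, zero_add, Finset.card_eq_one]
    exact ⟨x, by ext; simp [reachable_empty]⟩
  | insert e F heF ih =>
    have hF' : IsAcyclic ends F := hF.mono (Finset.subset_insert _ _)
    obtain ⟨u, v, huv⟩ : ∃ u v, ends e = s(u, v) := by
      induction h : ends e with | _ u v => exact ⟨u, v, rfl⟩
    have hn := hF.not_reachable heF huv
    have hemem : e ∈ insert e F := Finset.mem_insert_self _ _
    by_cases hx : Reachable ends F x u ∨ Reachable ends F x v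
    · have key : ∀ y, Reachable ends (insert e F) y x ↔
          Reachable ends F y u ∨ Reachable ends F y v := by
        intro y
        rw [reachable_insert huv]
        constructor
        · rintro (h | ⟨h, _⟩ | ⟨h, _⟩)
          · exact hx.imp h.trans h.trans
          · exact Or.inl h
          · exact Or.inr h
        · rintro (h | h) <;> rcases hx with h' | h'
          · exact Or.inl (h.trans h'.symm)
          · exact Or.inr (Or.inl ⟨h, h'.symm⟩)
          · exact Or.inr (Or.inr ⟨h, h'.symm⟩)
          · exact Or.inl (h.trans h'.symm)
      have hdis : ∀ y, Reachable ends F y u → ¬ Reachable ends F y v :=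
        fun y h h' => hn (h.symm.trans h')
      have hex : Reachable ends (insert e F) (ec ends e) x := by
        refine (ec_reach hemem (u := u) (by rw [huv]; simp)).trans ?_
        exact ((key u).2 (Or.inl (Reachable.refl _ _)))
      rw [Finset.filter_insert, if_pos hex, Finset.card_insert_of_notMem (by simp [heF])]
      simp only [key, Finset.filter_or]
      rw [Finset.card_union_of_disjoint, Finset.card_union_of_disjoint, ih hF' u, ih hF' v]
      · ring
      · rw [Finset.disjoint_filter]; exact fun f _ => hdis _
      · rw [Finset.disjoint_filter]; exact fun f _ => hdis _
    · push Not at hx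
      have key : ∀ y, Reachable ends (insert e F) y x ↔ Reachable ends F y x := by
        intro y
        rw [reachable_insert huv]
        constructor
        · rintro (h | ⟨_, h⟩ | ⟨_, h⟩)
          · exact h
          · exact absurd h.symm hx.2
          · exact absurd h.symm hx.1
        · exact Or.inl
      have hex : ¬ Reachable ends (insert e F) (ec ends e) x := by
        intro h
        have := ((ec_reach hemem (u := u) (by rw [huv]; simp)).symm.trans h)
        exact hx.1 ((key u).1 this).symm
      rw [Finset.filter_insert, if_neg hex]
      simp only [key]
      exact ih hF' x

end Basics

section Complex
variable {ε ν : Type} [DecidableEq ε] {ends : ε → Sym2 ν} {side : ν → Bool}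

/-- Edges of `K` lie in pairwise different components of `F`. -/
def Pw (ends : ε → Sym2 ν) (F K : Finset ε) : Prop :=
  K ⊆ F ∧ ∀ e ∈ K, ∀ f ∈ K, Reachable ends F (ec ends e) (ec ends f) → e = f

/-- The edge roots lie in different components. -/
def Ty1 (ends : ε → Sym2 ν) (F : Finset ε) (ρ : Multiset ε) : Prop :=
  ∃ K : Finset ε, ρ = K.val ∧ Pw ends F K

/-- Exactly one component has two edge roots, which satisfy the parity condition. -/
def Ty2 (ends : ε → Sym2 ν) (side : ν → Bool) (F : Finset ε) (ρ : Multiset ε) : Prop :=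
  ∃ (a b : ν) (e f : ε) (K : Finset ε), ρ = e ::ₘ f ::ₘ K.val ∧ side a ≠ side b ∧
    First ends F a b e ∧ First ends F b a f ∧ Pw ends F K ∧
    ∀ k ∈ K, ¬ Reachable ends F (ec ends k) a

/-- The multicomplex of 2-edge-rooted forests with edges in `X`. -/
def Del (ends : ε → Sym2 ν) (side : ν → Bool) (X : Finset ε) (μ : Multiset ε) : Prop :=
  ∃ (F : Finset ε) (ρ : Multiset ε), μ = F.val + ρ ∧ F ⊆ X ∧ IsAcyclic ends F ∧
    (Ty1 ends F ρ ∨ Ty2 ends side F ρ)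

theorem Pw.subset {F K K' : Finset ε} (h : Pw ends F K) (hK : K' ⊆ K) : Pw ends F K' :=
  ⟨hK.trans h.1, fun e he f hf => h.2 e (hK he) f (hK hf)⟩

theorem Pw.insert_of {F K : Finset ε} (h : Pw ends F K) {e : ε} (heF : e ∈ F)
    (he : ∀ k ∈ K, ¬ Reachable ends F (ec ends k) (ec ends e)) : Pw ends F (insert e K) := by
  refine ⟨Finset.insert_subset heF h.1, ?_⟩
  intro x hx y hy hr
  rcases Finset.mem_insert.1 hx with rfl | hx1 <;> rcases Finset.mem_insert.1 hy with rfl | hy1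
  · rfl
  · exact absurd hr.symm (he _ hy1)
  · exact absurd hr (he _ hx1)
  · exact h.2 x hx1 y hy1 hr

theorem Pw.erase_edge {F K : Finset ε} (h : Pw ends F K) {g : ε} (hg : g ∉ K) :
    Pw ends (F.erase g) K := by
  refine ⟨fun k hk => Finset.mem_erase.2 ⟨by rintro rfl; exact hg hk, h.1 hk⟩, ?_⟩
  intro e he f hf hr
  exact h.2 e he f hf (hr.mono (Finset.erase_subset _ _))

theorem First.ec_right {F : Finset ε} {a b : ν} {e : ε} (h : First ends F a b e) :
    Reachable ends F (ec ends e) a := ec_reach h.1 h.2.1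

theorem ty_sub {F : Finset ε} {ρ : Multiset ε} (h : Ty1 ends F ρ ∨ Ty2 ends side F ρ) :
    ∀ e ∈ ρ, e ∈ F := by
  intro e he
  rcases h with ⟨K, rfl, hK⟩ | ⟨a, b, e', f, K, rfl, _, h1, h2, hK, _⟩
  · exact hK.1 he
  · simp only [Multiset.mem_cons, Finset.mem_val] at he
    rcases he with rfl | rfl | he
    · exact h1.1
    · exact h2.1
    · exact hK.1 he

theorem del_toFinset {F : Finset ε} {ρ : Multiset ε} (h : ∀ e ∈ ρ, e ∈ F) :
    (F.val + ρ).toFinset = F := by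
  ext e
  simp only [Multiset.mem_toFinset, Multiset.mem_add, Finset.mem_val]
  exact ⟨fun hh => hh.elim id (h e), Or.inl⟩

/-- Removing an edge root. -/
theorem ty_erase_root {F : Finset ε} {ρ : Multiset ε} {g : ε}
    (h : Ty1 ends F (g ::ₘ ρ) ∨ Ty2 ends side F (g ::ₘ ρ)) :
    Ty1 ends F ρ ∨ Ty2 ends side F ρ := by
  rcases h with ⟨K, hρ, hK⟩ | ⟨a, b, e, f, K, hρ, hs, h1, h2, hK, hKa⟩
  · left
    refine ⟨K.erase g, ?_, hK.subset (Finset.erase_subset _ _)⟩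
    rw [Finset.erase_val, ← hρ, Multiset.erase_cons_head]
  · have hr : ρ = (e ::ₘ f ::ₘ K.val).erase g := by rw [← hρ, Multiset.erase_cons_head]
    have hab : Reachable ends F a b := h1.2.2.1
    by_cases hge : g = e
    · left
      subst hge
      rw [Multiset.erase_cons_head] at hr
      have hfa : ∀ k ∈ K, ¬ Reachable ends F (ec ends k) (ec ends f) := fun k hk hh =>
        hKa k hk (hh.trans (h2.ec_right.trans hab.symm))
      have hfK : f ∉ K := fun hf => hfa f hf (Reachable.refl _ _)
      refine ⟨insert f K, ?_, hK.insert_of h2.1 hfa⟩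
      rw [Finset.insert_val_of_notMem hfK, hr]
    · by_cases hgf : g = f
      · left
        subst hgf
        rw [Multiset.cons_swap, Multiset.erase_cons_head] at hr
        have hfa : ∀ k ∈ K, ¬ Reachable ends F (ec ends k) (ec ends e) := fun k hk hh =>
          hKa k hk (hh.trans h1.ec_right)
        have hfK : e ∉ K := fun hf => hfa e hf (Reachable.refl _ _)
        refine ⟨insert e K, ?_, hK.insert_of h1.1 hfa⟩
        rw [Finset.insert_val_of_notMem hfK, hr]
      · right
        refine ⟨a, b, e, f, K.erase g, ?_, hs, h1, h2, hK.subset (Finset.erase_subset _ _), ?_⟩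
        · rw [hr, Multiset.erase_cons_tail _ (Ne.symm hge),
            Multiset.erase_cons_tail _ (Ne.symm hgf), Finset.erase_val]
        · exact fun k hk => hKa k (Finset.mem_of_mem_erase hk)

/-- Removing an edge without roots. -/
theorem ty_erase_edge {F : Finset ε} {ρ : Multiset ε} {g : ε} (hg : g ∉ ρ)
    (h : Ty1 ends F ρ ∨ Ty2 ends side F ρ) :
    Ty1 ends (F.erase g) ρ ∨ Ty2 ends side (F.erase g) ρ := by
  have hsub := Finset.erase_subset g F
  rcases h with ⟨K, rfl, hK⟩ | ⟨a, b, e, f, K, rfl, hs, h1, h2, hK, hKa⟩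
  · exact Or.inl ⟨K, rfl, hK.erase_edge hg⟩
  · simp only [Multiset.mem_cons, Finset.mem_val, not_or] at hg
    obtain ⟨hge, hgf, hgK⟩ := hg
    have he' : e ∈ F.erase g := Finset.mem_erase.2 ⟨Ne.symm hge, h1.1⟩
    have hf' : f ∈ F.erase g := Finset.mem_erase.2 ⟨Ne.symm hgf, h2.1⟩
    by_cases hr : Reachable ends (F.erase g) a b
    · right
      refine ⟨a, b, e, f, K, rfl, hs, ⟨he', h1.2.1, hr, fun hh => h1.2.2.2 (hh.mono ?_)⟩,
        ⟨hf', h2.2.1, hr.symm, fun hh => h2.2.2.2 (hh.mono ?_)⟩, hK.erase_edge hgK,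
        fun k hk hh => hKa k hk (hh.mono hsub)⟩
      · exact Finset.erase_subset_erase _ hsub
      · exact Finset.erase_subset_erase _ hsub
    · left
      have hab : Reachable ends F a b := h1.2.2.1
      have hfa : ∀ k ∈ K, ¬ Reachable ends (F.erase g) (ec ends k) (ec ends f) := fun k hk hh =>
        hKa k hk ((hh.mono hsub).trans (h2.ec_right.trans hab.symm))
      have hea : ∀ k ∈ insert f K, ¬ Reachable ends (F.erase g) (ec ends k) (ec ends e) := by
        intro k hk hh
        rcases Finset.mem_insert.1 hk with rfl | hk
        · exact hr ((ec_reach he' h1.2.1).symm.trans (hh.symm.trans (ec_reach hf' h2.2.1)))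
        · exact hKa k hk ((hh.mono hsub).trans h1.ec_right)
      have hfK : f ∉ K := fun hf => hfa f hf (Reachable.refl _ _)
      have heK : e ∉ insert f K := fun hf => hea e hf (Reachable.refl _ _)
      refine ⟨insert e (insert f K), ?_, ((hK.erase_edge hgK).insert_of hf' hfa).insert_of he' hea⟩
      rw [Finset.insert_val_of_notMem heK, Finset.insert_val_of_notMem hfK]

/-- The 2-edge-rooted forests form a multicomplex. -/
theorem Del.of_le {X : Finset ε} {μ μ' : Multiset ε} (h : Del ends side X μ) (hle : μ' ≤ μ) :
    Del ends side X μ' := by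
  obtain ⟨τ, rfl⟩ := Multiset.le_iff_exists_add.1 hle
  induction τ using Multiset.induction_on with
  | empty => simpa using h
  | cons g τ ih =>
    refine ih ?_ (Multiset.le_add_right _ _)
    rw [Multiset.add_cons] at h
    generalize μ' + τ = σ at h
    obtain ⟨F, ρ, hμ, hX, hF, hty⟩ := h
    have hs : σ = (F.val + ρ).erase g := by rw [← hμ, Multiset.erase_cons_head]
    by_cases hg : g ∈ ρ
    · obtain ⟨ρ', rfl⟩ := Multiset.exists_cons_of_mem hg
      refine ⟨F, ρ', ?_, hX, hF, ty_erase_root hty⟩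
      rw [hs, Multiset.add_cons, Multiset.erase_cons_head]
    · have hgF : g ∈ F := by
        have : g ∈ F.val + ρ := by rw [← hμ]; simp
        rcases Multiset.mem_add.1 this with h | h
        · exact h
        · exact absurd h hg
      refine ⟨F.erase g, ρ, ?_, (Finset.erase_subset _ _).trans hX,
        hF.mono (Finset.erase_subset _ _), ty_erase_edge hg hty⟩
      rw [hs, Multiset.erase_add_left_pos _ (by simpa using hgF), Finset.erase_val]

theorem del_zero (X : Finset ε) : Del ends side X 0 :=
  ⟨∅, 0, by simp, by simp, isAcyclic_empty, Or.inl ⟨∅, by simp, by simp [Pw]⟩⟩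

/-- Component setoid. -/
def rSetoid (ends : ε → Sym2 ν) (F : Finset ε) : Setoid ν where
  r := Reachable ends F
  iseqv := ⟨Reachable.refl F, Reachable.symm, Reachable.trans⟩

/-- The type of components. -/
abbrev Cmp (ends : ε → Sym2 ν) (F : Finset ε) : Type := Quotient (rSetoid ends F)

/-- The component of a vertex. -/
def cq (ends : ε → Sym2 ν) (F : Finset ε) (v : ν) : Cmp ends F := Quotient.mk _ v

theorem cq_eq {F : Finset ε} {u v : ν} : cq ends F u = cq ends F v ↔ Reachable ends F u v :=
  Quotient.eq (r := rSetoid ends F)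

theorem cq_surj (F : Finset ε) (q : Cmp ends F) : ∃ v, cq ends F v = q := Quotient.exists_rep q

instance [Fintype ν] (F : Finset ε) : Fintype (Cmp ends F) := Fintype.ofFinite _

theorem card_comp_fiber [Fintype ν] {F : Finset ε} (hF : IsAcyclic ends F) (q : Cmp ends F) :
    (Finset.univ.filter fun v => cq ends F v = q).card =
      (F.filter fun e => cq ends F (ec ends e) = q).card + 1 := by
  obtain ⟨x, rfl⟩ := cq_surj F q
  simp only [cq_eq]
  exact card_component hF x

theorem card_forest [Fintype ν] {F : Finset ε} (hF : IsAcyclic ends F) :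
    F.card + Fintype.card (Cmp ends F) = Fintype.card ν := by
  rw [← Finset.card_univ (α := ν), Finset.card_eq_sum_card_fiberwise (f := cq ends F)
    (t := Finset.univ) (by intro x _; simp), Finset.card_eq_sum_card_fiberwise
    (f := fun e => cq ends F (ec ends e)) (s := F) (t := Finset.univ) (by intro x _; simp)]
  rw [← Finset.card_univ, Finset.card_eq_sum_ones, ← Finset.sum_add_distrib]
  exact Finset.sum_congr rfl fun q _ => (card_comp_fiber hF q).symm

end Complex

section Purity
variable {ε ν : Type} [DecidableEq ε] {ends : ε → Sym2 ν} {side : ν → Bool}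

theorem isolated_reach {F : Finset ε} {v : ν} (hv : ∀ e ∈ F, v ∉ ends e) {y : ν}
    (h : Reachable ends F y v) : y = v := by
  refine Reachable.ind (motive := fun y => y = v) rfl ?_ h
  rintro a b e he hab _ rfl
  exact absurd (by rw [hab]; simp) (hv e he)

theorem iso_insert {F : Finset ε} {v w : ν} {g : ε} (hg : ends g = s(v, w))
    (hv : ∀ e ∈ F, v ∉ ends e) {x y : ν} (hx : x ≠ v) (hy : y ≠ v)
    (h : Reachable ends (insert g F) x y) : Reachable ends F x y := by
  rcases (reachable_insert hg).1 h with h | ⟨h, _⟩ | ⟨_, h⟩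
  · exact h
  · exact absurd (isolated_reach hv h) hx
  · exact absurd (isolated_reach hv h.symm) hy

theorem First.insert_iso {F : Finset ε} {v w : ν} {g : ε} (hg : ends g = s(v, w))
    (hv : ∀ e ∈ F, v ∉ ends e) {a b : ν} {e : ε} (h : First ends F a b e) (hb : b ≠ v) :
    First ends (insert g F) a b e := by
  have ha : a ≠ v := by rintro rfl; exact hv e h.1 h.2.1
  have hge : g ≠ e := by rintro rfl; exact hv g h.1 (by rw [hg]; simp)
  refine ⟨Finset.mem_insert_of_mem h.1, h.2.1, h.2.2.1.mono (Finset.subset_insert _ _), ?_⟩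
  rw [Finset.erase_insert_of_ne hge]
  intro hh
  exact h.2.2.2 (iso_insert hg (fun e he => hv e (Finset.mem_of_mem_erase he)) ha hb hh)

/-- An edge towards an isolated vertex can always be added. -/
theorem ty_insert_iso {F : Finset ε} {ρ : Multiset ε} {v w : ν} {g : ε} (hg : ends g = s(v, w))
    (hv : ∀ e ∈ F, v ∉ ends e) (h : Ty1 ends F ρ ∨ Ty2 ends side F ρ) :
    Ty1 ends (insert g F) ρ ∨ Ty2 ends side (insert g F) ρ := by
  have hne : ∀ e ∈ F, ec ends e ≠ v := by
    rintro e he rfl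
    exact hv e he (ec_mem e)
  have hPw : ∀ K, Pw ends F K → Pw ends (insert g F) K := by
    intro K hK
    refine ⟨hK.1.trans (Finset.subset_insert _ _), fun e he f hf hr => hK.2 e he f hf ?_⟩
    exact iso_insert hg hv (hne e (hK.1 he)) (hne f (hK.1 hf)) hr
  rcases h with ⟨K, rfl, hK⟩ | ⟨a, b, e, f, K, rfl, hs, h1, h2, hK, hKa⟩
  · exact Or.inl ⟨K, rfl, hPw K hK⟩
  · have ha : a ≠ v := by rintro rfl; exact hv e h1.1 h1.2.1
    have hb : b ≠ v := by rintro rfl; exact hv f h2.1 h2.2.1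
    exact Or.inr ⟨a, b, e, f, K, rfl, hs, h1.insert_iso hg hv hb, h2.insert_iso hg hv ha,
      hPw K hK, fun k hk hh => hKa k hk (iso_insert hg hv (hne k (hK.1 hk)) ha hh)⟩

/-- The isolated vertices of the graph with edge set `X`. -/
def Iso [Fintype ν] (ends : ε → Sym2 ν) (X : Finset ε) : Finset ν :=
  Finset.univ.filter fun v => ∀ e ∈ X, ∀ w, ends e = s(v, w) → v = w

theorem count_roots [Fintype ν] {X F K : Finset ε} (hX : F ⊆ X) (hF : IsAcyclic ends F)
    (hK : Pw ends F K) (hroot : ∀ e ∈ F, ∃ k ∈ K, Reachable ends F (ec ends e) (ec ends k))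
    (hiso : ∀ v, (∀ e ∈ F, v ∉ ends e) → v ∈ Iso ends X) :
    F.card + K.card + (Iso ends X).card = Fintype.card ν := by
  have hiso' : ∀ v ∈ Iso ends X, ∀ e ∈ F, v ∉ ends e := by
    intro v hv e he hve
    obtain ⟨w, hw⟩ := Sym2.mem_iff_exists.1 hve
    have := (Finset.mem_filter.1 hv).2 e (hX he) w hw
    subst this
    exact hF e he v v hw (Reachable.refl _ _)
  have huniv : (Finset.univ : Finset (Cmp ends F)) =
      K.image (fun k => cq ends F (ec ends k)) ∪ (Iso ends X).image (cq ends F) := by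
    symm
    rw [Finset.eq_univ_iff_forall]
    intro q
    obtain ⟨v, rfl⟩ := cq_surj F q
    rw [Finset.mem_union, Finset.mem_image, Finset.mem_image]
    by_cases hv : ∀ e ∈ F, v ∉ ends e
    · exact Or.inr ⟨v, hiso v hv, rfl⟩
    · push Not at hv
      obtain ⟨e, he, hve⟩ := hv
      obtain ⟨k, hk, hr⟩ := hroot e he
      exact Or.inl ⟨k, hk, cq_eq.2 (hr.symm.trans (ec_reach he hve))⟩
  rw [← card_forest hF, ← Finset.card_univ (α := Cmp ends F), huniv,
    Finset.card_union_of_disjoint, Finset.card_image_of_injOn, Finset.card_image_of_injOn, add_assoc]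
  · intro u _ v hv huv
    exact isolated_reach (hiso' v hv) (cq_eq.1 huv)
  · intro e he f hf hef
    exact hK.2 e he f hf (cq_eq.1 hef)
  · rw [Finset.disjoint_left]
    intro q hq hq'
    obtain ⟨k, hk, rfl⟩ := Finset.mem_image.1 hq
    obtain ⟨v, hv, hvk⟩ := Finset.mem_image.1 hq'
    have := isolated_reach (hiso' v hv) (cq_eq.1 hvk).symm
    exact hiso' v hv k (hK.1 hk) (this ▸ ec_mem k)

/-- There is a bridging edge. -/
def HasBridge (ends : ε → Sym2 ν) (side : ν → Bool) (X : Finset ε) : Prop :=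
  ∃ e ∈ X, ∃ u v, ends e = s(u, v) ∧ side u ≠ side v

theorem exists_bridge {F : Finset ε} {a b : ν} (h : Reachable ends F a b) (hs : side a ≠ side b) :
    HasBridge ends side F := by
  by_contra hcon
  refine hs (Reachable.ind (motive := fun a => side a = side b) rfl ?_ h)
  intro u v e he huv _ ih
  by_contra hne
  exact hcon ⟨e, he, u, v, huv, by rwa [ih]⟩

/-- In a component meeting both sides, each edge root can be paired. -/
theorem exists_first_of_edge {F : Finset ε} {k : ε} (hk : k ∈ F) {u v : ν}
    (hu : Reachable ends F (ec ends k) u) (hv : Reachable ends F (ec ends k) v)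
    (hF : IsAcyclic ends F) (hs : side u ≠ side v) :
    ∃ a b, side a ≠ side b ∧ First ends F a b k := by
  obtain ⟨y, hy⟩ := Sym2.mem_iff_exists.1 (ec_mem (ends := ends) k)
  generalize ec ends k = x at hu hv hy
  have hn := hF k hk x y hy
  have hxy : Reachable ends F x y := Reachable.edge hk hy
  by_cases hxs : side x = side y
  · obtain ⟨w, hw, hxw⟩ : ∃ w, Reachable ends F x w ∧ side x ≠ side w := by
      by_cases h : side x = side u
      · exact ⟨v, hv, by rwa [h]⟩
      · exact ⟨u, hu, h⟩
    rcases Reachable.split hk hy hw.symm with h | h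
    · exact ⟨y, w, by rwa [← hxs], hk, by rw [hy]; simp, hxy.symm.trans hw,
        fun hh => hn (hh.trans h).symm⟩
    · exact ⟨x, w, hxw, hk, by rw [hy]; simp, hw, fun hh => hn (hh.trans h)⟩
  · exact ⟨x, y, hxs, hk, by rw [hy]; simp, hxy, hn⟩

/-- The far end of an edge. -/
theorem exists_far {F : Finset ε} {k : ε} (hk : k ∈ F) {u : ν}
    (hu : Reachable ends F (ec ends k) u) (hF : IsAcyclic ends F) :
    ∃ a, First ends F a u k := by
  obtain ⟨y, hy⟩ := Sym2.mem_iff_exists.1 (ec_mem (ends := ends) k)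
  generalize ec ends k = x at hu hy
  have hn := hF k hk x y hy
  have hxy : Reachable ends F x y := Reachable.edge hk hy
  rcases Reachable.split hk hy hu.symm with h | h
  · exact ⟨y, hk, by rw [hy]; simp, hxy.symm.trans hu, fun hh => hn (hh.trans h).symm⟩
  · exact ⟨x, hk, by rw [hy]; simp, hu, fun hh => hn (hh.trans h)⟩

theorem First.join {F : Finset ε} {g k : ε} {a b u v : ν} (hg : ends g = s(u, v)) (hgF : g ∉ F)
    (huv : ¬ Reachable ends F u v) (ha : First ends F a u k) (hb : Reachable ends F b v) :
    First ends (insert g F) a b k := by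
  have hsub := Finset.subset_insert g F
  have hgk : g ≠ k := by rintro rfl; exact hgF ha.1
  have hE : Reachable ends (insert g F) u v := Reachable.edge (Finset.mem_insert_self _ _) hg
  refine ⟨hsub ha.1, ha.2.1,
    (ha.2.2.1.mono hsub).trans (hE.trans (hb.symm.mono hsub)), ?_⟩
  rw [Finset.erase_insert_of_ne hgk, reachable_insert hg]
  have he := Finset.erase_subset k F
  rintro (h | ⟨h, _⟩ | ⟨h, _⟩)
  · exact huv (ha.2.2.1.symm.trans ((h.mono he).trans hb))
  · exact ha.2.2.2 h
  · exact huv (ha.2.2.1.symm.trans (h.mono he))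

/-- The cardinality of every maximal member. -/
theorem Del.card_of_maximal [Fintype ν] {X : Finset ε} {μ : Multiset ε}
    (h : Del ends side X μ) (hmax : ∀ τ, Del ends side X τ → μ ≤ τ → τ = μ) :
    Multiset.card μ + (Iso ends X).card =
      Fintype.card ν + if HasBridge ends side X then 1 else 0 := by
  obtain ⟨F, ρ, rfl, hX, hF, hty⟩ := h
  have no_root : ∀ e, ¬ (Ty1 ends F (e ::ₘ ρ) ∨ Ty2 ends side F (e ::ₘ ρ)) := by
    intro e he
    have := hmax (F.val + (e ::ₘ ρ)) ⟨F, _, rfl, hX, hF, he⟩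
      (by rw [Multiset.add_cons]; exact Multiset.le_cons_self _ _)
    have := congrArg Multiset.card this
    simp at this
  have no_edge : ∀ g ∈ X, g ∉ F → IsAcyclic ends (insert g F) →
      ¬ (Ty1 ends (insert g F) ρ ∨ Ty2 ends side (insert g F) ρ) := by
    intro g hgX hgF hac hh
    have hv : (insert g F).val = g ::ₘ F.val := Finset.insert_val_of_notMem hgF
    have := hmax ((insert g F).val + ρ) ⟨_, _, rfl, Finset.insert_subset hgX hX, hac, hh⟩
      (by rw [hv, Multiset.cons_add]; exact Multiset.le_cons_self _ _)
    have := congrArg Multiset.card this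
    rw [hv] at this
    simp at this
  have hiso : ∀ v, (∀ e ∈ F, v ∉ ends e) → v ∈ Iso ends X := by
    intro v hv
    refine Finset.mem_filter.2 ⟨Finset.mem_univ _, ?_⟩
    intro g hgX w hw
    by_contra hne
    have hgF : g ∉ F := fun hgF => hv g hgF (by rw [hw]; simp)
    exact no_edge g hgX hgF (hF.insert_edge hw fun hr => hne (isolated_reach hv hr.symm).symm)
      (ty_insert_iso hw hv hty)
  rcases hty with ⟨K, rfl, hK⟩ | ⟨a, b, e, f, K, rfl, hs, h1, h2, hK, hKa⟩
  · have hroot : ∀ e ∈ F, ∃ k ∈ K, Reachable ends F (ec ends e) (ec ends k) := by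
      intro e he
      by_contra hcon
      push Not at hcon
      have heK : e ∉ K := fun h => hcon e h (Reachable.refl _ _)
      refine no_root e (Or.inl ⟨insert e K, (Finset.insert_val_of_notMem heK).symm,
        hK.insert_of he fun k hk hh => hcon k hk hh.symm⟩)
    -- components are one-sided
    have hone : ∀ u v, Reachable ends F u v → side u = side v := by
      intro u v huv
      by_contra hs
      obtain ⟨g, hg, x, y, hxy, -⟩ := exists_bridge huv hs
      have hue : ∃ e ∈ F, u ∈ ends e := by
        by_contra hcon
        push Not at hcon
        exact hs (by rw [isolated_reach hcon huv.symm])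
      obtain ⟨e, he, hue⟩ := hue
      obtain ⟨k, hk, hr⟩ := hroot e he
      have hku : Reachable ends F (ec ends k) u := hr.symm.trans (ec_reach he hue)
      obtain ⟨a, b, hab, hfirst⟩ := exists_first_of_edge (hK.1 hk) hku (hku.trans huv) hF hs
      obtain ⟨f, hf⟩ := First.exists hF hfirst.2.2.1.symm hfirst.ne.symm
      refine no_root f (Or.inr ⟨a, b, k, f, K.erase k, ?_, hab, hfirst, hf,
        hK.subset (Finset.erase_subset _ _), ?_⟩)
      · rw [Multiset.cons_swap, Finset.erase_val, Multiset.cons_erase (by simpa using hk)]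
      · intro k' hk' hh
        exact Finset.ne_of_mem_erase hk' (hK.2 k' (Finset.mem_of_mem_erase hk') k hk
          (hh.trans hfirst.ec_right.symm))
    have hnb : ¬ HasBridge ends side X := by
      rintro ⟨g, hgX, u, v, huv, hs⟩
      have hnr : ¬ Reachable ends F u v := fun hr => hs (hone u v hr)
      have hgF : g ∉ F := fun hgF => hnr (Reachable.edge hgF huv)
      have hac := hF.insert_edge huv hnr
      have hroot' : ∀ x ∈ ends g, ∃ k ∈ K, Reachable ends F (ec ends k) x := by
        intro x hx
        have : ∃ e ∈ F, x ∈ ends e := by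
          by_contra hcon
          push Not at hcon
          have := (Finset.mem_filter.1 (hiso x hcon)).2 g hgX
          rw [huv] at hx
          rcases Sym2.mem_iff.1 hx with rfl | rfl
          · exact hs (by rw [this v huv])
          · exact hs (by rw [this u (by rw [huv, Sym2.eq_swap])])
        obtain ⟨e, he, hxe⟩ := this
        obtain ⟨k, hk, hr⟩ := hroot e he
        exact ⟨k, hk, hr.symm.trans (ec_reach he hxe)⟩
      obtain ⟨k, hk, hku⟩ := hroot' u (by rw [huv]; simp)
      obtain ⟨l, hl, hlv⟩ := hroot' v (by rw [huv]; simp)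
      obtain ⟨a, ha⟩ := exists_far (hK.1 hk) hku hF
      obtain ⟨b, hb⟩ := exists_far (hK.1 hl) hlv hF
      have hkl : k ≠ l := by rintro rfl; exact hnr (hku.symm.trans hlv)
      have hg' : ends g = s(v, u) := by rw [huv, Sym2.eq_swap]
      have hsub : (K.erase k).erase l ⊆ K :=
        (Finset.erase_subset _ _).trans (Finset.erase_subset _ _)
      have hfar : ∀ x ∈ (K.erase k).erase l, ¬ Reachable ends F (ec ends x) u ∧
          ¬ Reachable ends F (ec ends x) v := by
        intro x hx
        have hxK := hsub hx
        simp only [Finset.mem_erase] at hx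
        exact ⟨fun hh => hx.2.1 (hK.2 x hxK k hk (hh.trans hku.symm)),
          fun hh => hx.1 (hK.2 x hxK l hl (hh.trans hlv.symm))⟩
      refine no_edge g hgX hgF hac (Or.inr ⟨a, b, k, l, (K.erase k).erase l, ?_, ?_,
        ha.join huv hgF hnr hb.2.2.1,
        hb.join hg' hgF (fun hh => hnr hh.symm) ha.2.2.1, ⟨?_, ?_⟩, ?_⟩)
      · rw [Finset.erase_val, Multiset.cons_erase, Finset.erase_val, Multiset.cons_erase]
        · simpa using hk
        · exact (Finset.mem_erase.2 ⟨hkl.symm, hl⟩ : l ∈ K.erase k)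
      · rw [hone a u ha.2.2.1, hone b v hb.2.2.1]; exact hs
      · exact (hsub.trans hK.1).trans (Finset.subset_insert _ _)
      · intro x hx y hy hr
        refine hK.2 x (hsub hx) y (hsub hy) ?_
        rcases (reachable_insert huv).1 hr with h | ⟨h, _⟩ | ⟨h, _⟩
        · exact h
        · exact absurd h (hfar x hx).1
        · exact absurd h (hfar x hx).2
      · intro x hx hr
        rcases (reachable_insert huv).1 hr with h | ⟨h, _⟩ | ⟨h, _⟩
        · exact (hfar x hx).1 (h.trans ha.2.2.1)
        · exact (hfar x hx).1 h
        · exact (hfar x hx).2 h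
    rw [if_neg hnb, ← count_roots hX hF hK hroot hiso]
    simp
  · have hea : ∀ k ∈ K, ¬ Reachable ends F (ec ends k) (ec ends e) := fun k hk hh =>
      hKa k hk (hh.trans h1.ec_right)
    have heK : e ∉ K := fun h => hea e h (Reachable.refl _ _)
    have hK' := hK.insert_of h1.1 hea
    have hroot : ∀ g ∈ F, ∃ k ∈ insert e K, Reachable ends F (ec ends g) (ec ends k) := by
      intro g hg
      by_contra hcon
      push Not at hcon
      have hgK : g ∉ K := fun h => hcon g (Finset.mem_insert_of_mem h) (Reachable.refl _ _)
      refine no_root g (Or.inr ⟨a, b, e, f, insert g K, ?_, hs, h1, h2,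
        hK.insert_of hg fun k hk hh => hcon k (Finset.mem_insert_of_mem hk) hh.symm, ?_⟩)
      · rw [Finset.insert_val_of_notMem hgK, Multiset.cons_swap g e, Multiset.cons_swap g f]
      · intro k hk hh
        rcases Finset.mem_insert.1 hk with rfl | hk
        · exact hcon e (Finset.mem_insert_self _ _) (hh.trans h1.ec_right.symm)
        · exact hKa k hk hh
    have hb : HasBridge ends side X := by
      obtain ⟨g, hg, h⟩ := exists_bridge h1.2.2.1 hs
      exact ⟨g, hX hg, h⟩
    rw [if_pos hb, ← count_roots hX hF hK' hroot hiso, Finset.card_insert_of_notMem heK]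
    simp
    ring

end Purity

section Transversal

/-- Partial transversals of the fibres of `c` over `R`. -/
def Trans {α Q : Type} (U : Finset α) (c : α → Q) (R : Finset Q) : Finset (Finset α) :=
  U.powerset.filter fun K => Set.InjOn c K ∧ ∀ x ∈ K, c x ∈ R

theorem mem_trans {α Q : Type} {U : Finset α} {c : α → Q} {R : Finset Q} {K : Finset α} :
    K ∈ Trans U c R ↔ K ⊆ U ∧ Set.InjOn c K ∧ ∀ x ∈ K, c x ∈ R := by
  simp [Trans]

theorem card_le_of_mem_trans {α Q : Type} {U : Finset α} {c : α → Q} {R : Finset Q} {K : Finset α}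
    (h : K ∈ Trans U c R) : K.card ≤ R.card := by
  rw [mem_trans] at h
  rw [← Finset.card_image_of_injOn h.2.1]
  apply Finset.card_le_card
  intro q hq
  obtain ⟨x, hx, rfl⟩ := Finset.mem_image.1 hq
  exact h.2.2 x hx

theorem sum_trans {α Q S : Type} [CommSemiring S] (U : Finset α) (c : α → Q) (R : Finset Q)
    (t : S) : ∑ K ∈ Trans U c R, t ^ (R.card - K.card) =
      ∏ q ∈ R, (t + ((U.filter fun x => c x = q).card : S)) := by
  induction R using Finset.induction_on with
  | empty =>
    have : Trans U c ∅ = {∅} := by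
      ext K
      rw [mem_trans, Finset.mem_singleton]
      constructor
      · rintro ⟨_, _, h⟩
        exact Finset.eq_empty_of_forall_notMem fun x hx => absurd (h x hx) (Finset.notMem_empty _)
      · rintro rfl
        simp
    rw [this]
    simp
  | insert q R hq ih =>
    rw [Finset.prod_insert hq, ← ih, add_mul,
      ← Finset.sum_filter_add_sum_filter_not (Trans U c (insert q R)) (fun K => ∀ x ∈ K, c x ≠ q)]
    congr 1
    · have : (Trans U c (insert q R)).filter (fun K => ∀ x ∈ K, c x ≠ q) = Trans U c R := by
        ext K
        simp only [Finset.mem_filter, mem_trans, Finset.mem_insert]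
        constructor
        · rintro ⟨⟨h1, h2, h3⟩, h4⟩
          exact ⟨h1, h2, fun x hx => (h3 x hx).resolve_left (h4 x hx)⟩
        · rintro ⟨h1, h2, h3⟩
          exact ⟨⟨h1, h2, fun x hx => Or.inr (h3 x hx)⟩, fun x hx h => hq (h ▸ h3 x hx)⟩
      rw [this, Finset.mul_sum]
      refine Finset.sum_congr rfl fun K hK => ?_
      have := card_le_of_mem_trans hK
      rw [Finset.card_insert_of_notMem hq, Nat.sub_add_comm this, pow_succ']
    · rw [← nsmul_eq_mul, ← Finset.sum_const, Finset.sum_congr rfl (g := fun _ =>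
        ∑ K ∈ Trans U c R, t ^ (R.card - K.card)) (fun _ _ => rfl),
        ← Finset.sum_product' (s := U.filter fun x => c x = q) (t := Trans U c R)
          (f := fun _ K => t ^ (R.card - K.card))]
      symm
      refine Finset.sum_bij (fun p _ => insert p.1 p.2) ?_ ?_ ?_ ?_
      · rintro ⟨x, K⟩ hp
        simp only [Finset.mem_product, Finset.mem_filter, mem_trans] at hp
        obtain ⟨⟨hxU, hx⟩, hKU, hK, hKR⟩ := hp
        simp only [Finset.mem_filter, mem_trans]
        refine ⟨⟨Finset.insert_subset hxU hKU, ?_, ?_⟩, ?_⟩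
        · rw [Finset.coe_insert, Set.injOn_insert]
          · refine ⟨hK, ?_⟩
            rintro ⟨y, hy, hyx⟩
            exact hq (by rw [← hx, ← hyx]; exact hKR y hy)
          · intro hxK
            exact hq (by rw [← hx]; exact hKR x hxK)
        · intro y hy
          rcases Finset.mem_insert.1 hy with rfl | hy
          · rw [hx]; exact Finset.mem_insert_self _ _
          · exact Finset.mem_insert_of_mem (hKR y hy)
        · intro h
          exact h x (Finset.mem_insert_self _ _) hx
      · rintro ⟨x, K⟩ hp ⟨y, L⟩ hp' heq
        simp only [Finset.mem_product, Finset.mem_filter, mem_trans] at hp hp' heq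
        obtain ⟨⟨hxU, hx⟩, hKU, hK, hKR⟩ := hp
        obtain ⟨⟨hyU, hy⟩, hLU, hL, hLR⟩ := hp'
        have hxK : ∀ w, c w = q → w ∉ K := fun w hw h => hq (by rw [← hw]; exact hKR w h)
        have hxL : ∀ w, c w = q → w ∉ L := fun w hw h => hq (by rw [← hw]; exact hLR w h)
        have hxy : x = y := by
          have : x ∈ insert y L := heq ▸ Finset.mem_insert_self x K
          exact (Finset.mem_insert.1 this).resolve_right (hxL x hx)
        subst hxy
        rw [← Finset.erase_insert (hxK x hx), ← Finset.erase_insert (hxL x hx), heq]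
      · intro K hK
        simp only [Finset.mem_filter, mem_trans] at hK
        obtain ⟨⟨hKU, hKi, hKR⟩, hne⟩ := hK
        push Not at hne
        obtain ⟨x, hx, hxq⟩ := hne
        refine ⟨(x, K.erase x), ?_, Finset.insert_erase hx⟩
        simp only [Finset.mem_product, Finset.mem_filter, mem_trans]
        refine ⟨⟨hKU hx, hxq⟩, (Finset.erase_subset _ _).trans hKU,
          hKi.mono (Finset.coe_subset.2 (Finset.erase_subset _ _)), ?_⟩
        intro y hy
        have hy' := Finset.mem_of_mem_erase hy
        refine (Finset.mem_insert.1 (hKR y hy')).resolve_left fun h => ?_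
        exact Finset.ne_of_mem_erase hy (hKi hy' hx (by rw [h, hxq]))
      · rintro ⟨x, K⟩ hp
        simp only [Finset.mem_product, Finset.mem_filter, mem_trans] at hp
        obtain ⟨⟨hxU, hx⟩, hKU, hK, hKR⟩ := hp
        have hxK : x ∉ K := fun h => hq (by rw [← hx]; exact hKR x h)
        simp only
        rw [Finset.card_insert_of_notMem hq, Finset.card_insert_of_notMem hxK, Nat.add_sub_add_right]

end Transversal

/-- Abstract description of a biconed graph. -/
structure Setup (ε ν : Type) where
  ends : ε → Sym2 ν
  side : ν → Bool
  o : ν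
  o' : ν
  z : ε
  t : ν → ε
  X : Finset ε
  hz : ends z = s(o, o')
  hoo : o ≠ o'
  so : side o = false
  so' : side o' = false
  zX : z ∉ X
  hX : ∀ e ∈ X, o ∉ ends e
  ht : ∀ v, v ≠ o → v ≠ o' → ends (t v) = s(if side v = true then o else o', v)
  tX : ∀ v, v ≠ o → v ≠ o' → t v ∉ X
  tz : ∀ v, v ≠ o → v ≠ o' → t v ≠ z
  tinj : ∀ v, v ≠ o → v ≠ o' → ∀ w, w ≠ o → w ≠ o' → t v = t w → v = w
  cover : ∀ e, e = z ∨ e ∈ X ∨ ∃ v, v ≠ o ∧ v ≠ o' ∧ e = t v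

namespace Setup
variable {ε ν : Type} [DecidableEq ε] (S : Setup ε ν)

/-- A set of ordinary vertices. -/
def Good (Y : Finset ν) : Prop := ∀ y ∈ Y, y ≠ S.o ∧ y ≠ S.o'

def hub (v : ν) : ν := if S.side v = true then S.o else S.o'

variable {S}

theorem o_iso {F : Finset ε} (hF : F ⊆ S.X) : ∀ e ∈ F, S.o ∉ S.ends e :=
  fun e he => S.hX e (hF he)

theorem reach_oo (F : Finset ε) : Reachable S.ends (insert S.z F) S.o S.o' :=
  Reachable.edge (Finset.mem_insert_self _ _) S.hz

theorem hub_reach {F : Finset ε} (hz : S.z ∈ F) (v : ν) : Reachable S.ends F (S.hub v) S.o := by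
  unfold hub
  split
  · exact Reachable.refl _ _
  · exact (Reachable.edge hz S.hz).symm

/-- Away from `o`, the edge `z` is irrelevant. -/
theorem reach_drop {F : Finset ε} (hF : F ⊆ S.X) {x y : ν} (hx : x ≠ S.o) (hy : y ≠ S.o)
    (h : Reachable S.ends (insert S.z F) x y) : Reachable S.ends F x y :=
  iso_insert S.hz (o_iso hF) hx hy h

theorem reach_o {F : Finset ε} (hF : F ⊆ S.X) {x : ν} (hx : x ≠ S.o)
    (h : Reachable S.ends (insert S.z F) x S.o) : Reachable S.ends F x S.o' :=
  reach_drop hF hx S.hoo.symm (h.trans (reach_oo F))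

theorem acyclic_z {F : Finset ε} (hF : F ⊆ S.X) (h : IsAcyclic S.ends F) :
    IsAcyclic S.ends (insert S.z F) :=
  h.insert_edge S.hz fun hr => S.hoo (isolated_reach (o_iso hF) hr.symm).symm

/-- The vertices connected to the hubs. -/
def Star (S : Setup ε ν) (F : Finset ε) (Y : Finset ν) (x : ν) : Prop :=
  Reachable S.ends F x S.o ∨ ∃ y ∈ Y, Reachable S.ends F x y

theorem star_reach {F : Finset ε} {Y : Finset ν} (hz : S.z ∈ F) (hY : S.Good Y) {x : ν}
    (h : S.Star F Y x) : Reachable S.ends (F ∪ Y.image S.t) x S.o := by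
  have hsub : F ⊆ F ∪ Y.image S.t := Finset.subset_union_left
  rcases h with h | ⟨y, hy, h⟩
  · exact h.mono hsub
  · have hty : S.t y ∈ F ∪ Y.image S.t :=
      Finset.mem_union_right _ (Finset.mem_image_of_mem _ hy)
    have h1 := Reachable.edge hty (S.ht y (hY y hy).1 (hY y hy).2)
    exact (h.mono hsub).trans (h1.symm.trans ((hub_reach hz y).mono hsub))

theorem reach_star {F : Finset ε} (hz : S.z ∈ F) {Y : Finset ν} (hY : S.Good Y) {x w : ν}
    (h : Reachable S.ends (F ∪ Y.image S.t) x w) :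
    Reachable S.ends F x w ∨ (S.Star F Y x ∧ S.Star F Y w) := by
  induction Y using Finset.induction_on generalizing x w with
  | empty => left; simpa using h
  | insert y Y hyY ih =>
    have hY' : S.Good Y := fun v hv => hY v (Finset.mem_insert_of_mem hv)
    have hy := hY y (Finset.mem_insert_self _ _)
    have hmono : ∀ v, S.Star F Y v → S.Star F (insert y Y) v := by
      rintro v (h | ⟨a, ha, h⟩)
      · exact Or.inl h
      · exact Or.inr ⟨a, Finset.mem_insert_of_mem ha, h⟩
    have hyS : ∀ v, Reachable S.ends F v y → S.Star F (insert y Y) v := fun v h =>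
      Or.inr ⟨y, Finset.mem_insert_self _ _, h⟩
    have k1 : ∀ v, Reachable S.ends (F ∪ Y.image S.t) v (S.hub y) → S.Star F (insert y Y) v := by
      intro v hv
      rcases ih hY' hv with h | ⟨h, _⟩
      · exact Or.inl (h.trans (hub_reach hz y))
      · exact hmono _ h
    have k2 : ∀ v, Reachable S.ends (F ∪ Y.image S.t) v y → S.Star F (insert y Y) v := by
      intro v hv
      rcases ih hY' hv with h | ⟨h, _⟩
      · exact hyS _ h
      · exact hmono _ h
    rw [Finset.image_insert, Finset.union_insert] at h
    rcases (reachable_insert (S.ht y hy.1 hy.2)).1 h with h | ⟨h1, h2⟩ | ⟨h1, h2⟩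
    · rcases ih hY' h with h | ⟨h1, h2⟩
      · exact Or.inl h
      · exact Or.inr ⟨hmono _ h1, hmono _ h2⟩
    · exact Or.inr ⟨k1 _ h1, k2 _ h2.symm⟩
    · exact Or.inr ⟨k2 _ h1, k1 _ h2.symm⟩

theorem t_notMem {F : Finset ε} (hF : F ⊆ S.X) {Y : Finset ν} (hY : S.Good Y) {y : ν}
    (hy : y ≠ S.o ∧ y ≠ S.o') (hyY : y ∉ Y) : S.t y ∉ insert S.z F ∪ Y.image S.t := by
  intro h
  rcases Finset.mem_union.1 h with h | h
  · rcases Finset.mem_insert.1 h with h | h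
    · exact S.tz y hy.1 hy.2 h
    · exact S.tX y hy.1 hy.2 (hF h)
  · obtain ⟨v, hv, hvy⟩ := Finset.mem_image.1 h
    exact hyY (S.tinj v (hY v hv).1 (hY v hv).2 y hy.1 hy.2 hvy ▸ hv)

/-- Acyclicity in the presence of the edge `z`. -/
theorem acyclic_iff_with {F : Finset ε} (hF : F ⊆ S.X) (hac : IsAcyclic S.ends F)
    {Y : Finset ν} (hY : S.Good Y) :
    IsAcyclic S.ends (insert S.z F ∪ Y.image S.t) ↔
      Set.InjOn (cq S.ends (insert S.z F)) Y ∧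
        ∀ y ∈ Y, cq S.ends (insert S.z F) y ≠ cq S.ends (insert S.z F) S.o := by
  have hz : S.z ∈ insert S.z F := Finset.mem_insert_self _ _
  induction Y using Finset.induction_on with
  | empty => simpa using acyclic_z hF hac
  | insert y Y hyY ih =>
    have hY' : S.Good Y := fun v hv => hY v (Finset.mem_insert_of_mem hv)
    have hy := hY y (Finset.mem_insert_self _ _)
    have hends := S.ht y hy.1 hy.2
    have hstar : Reachable S.ends (insert S.z F ∪ Y.image S.t) (S.hub y) y ↔
        S.Star (insert S.z F) Y y := by
      have hh := (hub_reach hz y).mono (Finset.subset_union_left (s₂ := Y.image S.t))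
      constructor
      · intro h
        rcases reach_star hz hY' (h.symm.trans hh) with h | h
        · exact Or.inl h
        · exact h.1
      · intro h
        exact hh.trans (star_reach hz hY' h).symm
    rw [Finset.image_insert, Finset.union_insert]
    constructor
    · intro h
      have h1 := (ih hY').1 (h.mono (Finset.subset_insert _ _))
      have h2 := h.not_reachable (t_notMem hF hY' hy hyY) hends
      change ¬ Reachable _ _ (S.hub y) y at h2
      rw [hstar] at h2
      constructor
      · rw [Finset.coe_insert, Set.injOn_insert (by simpa using hyY)]
        refine ⟨h1.1, ?_⟩
        rintro ⟨v, hv, hvy⟩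
        exact h2 (Or.inr ⟨v, hv, (cq_eq.1 hvy).symm⟩)
      · intro v hv
        rcases Finset.mem_insert.1 hv with rfl | hv
        · exact fun h => h2 (Or.inl (cq_eq.1 h))
        · exact h1.2 v hv
    · rintro ⟨h1, h2⟩
      rw [Finset.coe_insert, Set.injOn_insert (by simpa using hyY)] at h1
      refine ((ih hY').2 ⟨h1.1, fun v hv => h2 v (Finset.mem_insert_of_mem hv)⟩).insert_edge
        hends ?_
      change ¬ Reachable _ _ (S.hub y) y
      rw [hstar]
      rintro (h | ⟨v, hv, h⟩)
      · exact h2 y (Finset.mem_insert_self _ _) (cq_eq.2 h)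
      · exact h1.2 ⟨v, hv, (cq_eq.2 h).symm⟩

end Setup

namespace Setup
variable {ε ν : Type} [DecidableEq ε] [Fintype ε] [Fintype ν] (S : Setup ε ν)

/-- The component of a vertex in the forest with `z` added. -/
abbrev cc (F : Finset ε) (v : ν) : Cmp S.ends (insert S.z F) := cq S.ends (insert S.z F) v

/-- A pair of vertices of one component, on different sides. -/
def VP (F : Finset ε) (p : ν × ν) : Prop :=
  S.side p.1 = true ∧ S.side p.2 = false ∧ Reachable S.ends (insert S.z F) p.1 p.2 ∧
    (p.2 = S.o ∨ ¬ Reachable S.ends (insert S.z F) p.1 S.o)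

/-- The index set. -/
def Idx : Finset (Finset ε × Option (ν × ν)) :=
  Finset.univ.filter fun i => i.1 ⊆ S.X ∧ IsAcyclic S.ends i.1 ∧ ∀ p, i.2 = some p → S.VP i.1 p

/-- The components which may still carry a root. -/
def RR (F : Finset ε) : Option (ν × ν) → Finset (Cmp S.ends (insert S.z F))
  | none => Finset.univ.erase (S.cc F S.o)
  | some p => (Finset.univ.erase (S.cc F S.o)).erase (S.cc F p.1)

/-- Vertex choices. -/
def KV (i : Finset ε × Option (ν × ν)) : Finset (Finset ν) :=
  Trans Finset.univ (S.cc i.1) (S.RR i.1 i.2)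

/-- Edge choices. -/
def KE (i : Finset ε × Option (ν × ν)) : Finset (Finset ε) :=
  Trans (insert S.z i.1) (fun e => S.cc i.1 (ec S.ends e)) (S.RR i.1 i.2)

/-- The vertices of the distinguished pair, without `o`. -/
def base : Option (ν × ν) → Finset ν
  | none => ∅
  | some p => ({p.1, p.2} : Finset ν).erase S.o

/-- The forest belonging to an index and a vertex choice. -/
def V1 (i : Finset ε × Option (ν × ν)) (K : Finset ν) : Finset ε :=
  i.1 ∪ (K ∪ S.base i.2).image S.t

variable {S}

theorem sum_KV_eq_sum_KE {R : Type} [CommSemiring R] {i : Finset ε × Option (ν × ν)}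
    (hi : i ∈ S.Idx) (t : R) :
    ∑ K ∈ S.KV i, t ^ ((S.RR i.1 i.2).card - K.card) =
      ∑ K ∈ S.KE i, (t + 1) ^ ((S.RR i.1 i.2).card - K.card) := by
  unfold KV KE
  rw [sum_trans, sum_trans]
  refine Finset.prod_congr rfl fun q _ => ?_
  have hi' := (Finset.mem_filter.1 hi).2
  have h1 := card_comp_fiber (acyclic_z hi'.1 hi'.2.1) q
  rw [add_assoc, add_comm (1 : R), ← Nat.cast_succ]
  congr 2
  convert h1

theorem RR_avoid_o {F : Finset ε} {p : Option (ν × ν)} : S.cc F S.o ∉ S.RR F p := by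
  cases p <;> simp [RR]

theorem RR_avoid_p {F : Finset ε} {p : ν × ν} : S.cc F p.1 ∉ S.RR F (some p) := by
  simp [RR]

theorem mem_RR_none {F : Finset ε} {q : Cmp S.ends (insert S.z F)} :
    q ∈ S.RR F none ↔ q ≠ S.cc F S.o := by
  simp [RR]

theorem mem_RR_some {F : Finset ε} {q : Cmp S.ends (insert S.z F)} {p : ν × ν} :
    q ∈ S.RR F (some p) ↔ q ≠ S.cc F p.1 ∧ q ≠ S.cc F S.o := by
  simp [RR]

theorem VP.ne {F : Finset ε} {p : ν × ν} (h : S.VP F p) : p.1 ≠ p.2 := by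
  intro hh
  have h1 := h.1
  rw [hh, h.2.1] at h1
  exact Bool.noConfusion h1

theorem VP.a_ne {F : Finset ε} {p : ν × ν} (h : S.VP F p) : p.1 ≠ S.o ∧ p.1 ≠ S.o' := by
  constructor <;> intro hh <;> have h1 := h.1 <;> rw [hh] at h1
  · rw [S.so] at h1; exact Bool.noConfusion h1
  · rw [S.so'] at h1; exact Bool.noConfusion h1

theorem VP.b_ne {F : Finset ε} {p : ν × ν} (h : S.VP F p) (hb : p.2 ≠ S.o) : p.2 ≠ S.o' := by
  intro hh
  refine h.2.2.2.resolve_left hb (h.2.2.1.trans ?_)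
  rw [hh]
  exact (reach_oo F).symm

theorem VP.cb {F : Finset ε} {p : ν × ν} (h : S.VP F p) : S.cc F p.2 = S.cc F p.1 :=
  cq_eq.2 h.2.2.1.symm

theorem VP.co {F : Finset ε} {p : ν × ν} (h : S.VP F p) :
    p.2 = S.o ↔ S.cc F p.1 = S.cc F S.o := by
  constructor
  · intro hh
    rw [← hh, h.cb]
  · intro hh
    exact h.2.2.2.resolve_right (fun h' => h' (cq_eq.1 hh))

theorem good_KV {i : Finset ε × Option (ν × ν)} {K : Finset ν} (hK : K ∈ S.KV i) : S.Good K := by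
  intro y hy
  have h := (mem_trans.1 hK).2.2 y hy
  constructor
  · rintro rfl
    exact RR_avoid_o h
  · rintro rfl
    have : S.cc i.1 S.o' = S.cc i.1 S.o := cq_eq.2 (reach_oo _).symm
    rw [this] at h
    exact RR_avoid_o h

theorem good_base {F : Finset ε} {p : Option (ν × ν)} (hp : ∀ q, p = some q → S.VP F q) :
    S.Good (S.base p) := by
  cases p with
  | none => intro y hy; simp [base] at hy
  | some p =>
    have h := hp p rfl
    intro y hy
    simp only [base, Finset.mem_erase, Finset.mem_insert, Finset.mem_singleton] at hy
    refine ⟨hy.1, ?_⟩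
    rcases hy.2 with rfl | rfl
    · exact h.a_ne.2
    · exact h.b_ne hy.1

theorem good_union {Y Y' : Finset ν} (h : S.Good Y) (h' : S.Good Y') : S.Good (Y ∪ Y') :=
  fun y hy => (Finset.mem_union.1 hy).elim (h y) (h' y)

theorem disj_base {F : Finset ε} {p : Option (ν × ν)} (hp : ∀ q, p = some q → S.VP F q)
    {K : Finset ν} (hK : K ∈ S.KV (F, p)) : Disjoint K (S.base p) := by
  rw [Finset.disjoint_left]
  intro y hy hy'
  have h := (mem_trans.1 hK).2.2 y hy
  cases p with
  | none => simp [base] at hy'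
  | some p =>
    have hv := hp p rfl
    simp only [base, Finset.mem_erase, Finset.mem_insert, Finset.mem_singleton] at hy'
    rcases hy'.2 with rfl | rfl
    · exact RR_avoid_p h
    · have h2 := h
      rw [hv.cb] at h2
      exact RR_avoid_p h2

theorem card_V1 {i : Finset ε × Option (ν × ν)} (hi : i ∈ S.Idx) {K : Finset ν} (hK : K ∈ S.KV i) :
    (S.V1 i K).card = i.1.card + K.card + (S.base i.2).card := by
  obtain ⟨F, p⟩ := i
  have hi' := (Finset.mem_filter.1 hi).2
  have hg := good_union (good_KV hK) (good_base hi'.2.2)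
  unfold V1
  rw [Finset.card_union_of_disjoint, Finset.card_image_of_injOn,
    Finset.card_union_of_disjoint (disj_base hi'.2.2 hK), add_assoc]
  · intro v hv w hw h
    exact S.tinj v (hg v hv).1 (hg v hv).2 w (hg w hw).1 (hg w hw).2 h
  · rw [Finset.disjoint_right]
    intro e he heF
    obtain ⟨v, hv, rfl⟩ := Finset.mem_image.1 he
    exact S.tX v (hg v hv).1 (hg v hv).2 (hi'.1 heF)

/-- `1` for indices without a distinguished pair. -/
def dl (p : Option (ν × ν)) : ℕ := if p = none then 1 else 0

theorem card_RR {i : Finset ε × Option (ν × ν)} (hi : i ∈ S.Idx) :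
    i.1.card + (S.base i.2).card + (S.RR i.1 i.2).card + dl i.2 + 1 = Fintype.card ν := by
  obtain ⟨F, p⟩ := i
  have hi' := (Finset.mem_filter.1 hi).2
  have h1 := card_forest (acyclic_z hi'.1 hi'.2.1)
  have hzF : S.z ∉ F := fun h => S.zX (hi'.1 h)
  rw [Finset.card_insert_of_notMem hzF] at h1
  have hc : ((Finset.univ : Finset (Cmp S.ends (insert S.z F))).erase (S.cc F S.o)).card + 1 =
      Fintype.card (Cmp S.ends (insert S.z F)) := by
    rw [Finset.card_erase_add_one (Finset.mem_univ _), Finset.card_univ]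
  cases p with
  | none =>
    simp only [base, RR, dl, Finset.card_empty, if_true]
    simp only at h1 hc
    omega
  | some p =>
    have hv := hi'.2.2 p rfl
    simp only [base, RR, dl]
    simp only at h1 hc hv
    by_cases hb : p.2 = S.o
    · have h2 : ({p.1, p.2} : Finset ν).erase S.o = {p.1} := by
        ext x
        simp only [Finset.mem_erase, Finset.mem_insert, Finset.mem_singleton]
        constructor
        · rintro ⟨h, rfl | rfl⟩
          · rfl
          · exact absurd hb h
        · rintro rfl
          exact ⟨hv.a_ne.1, Or.inl rfl⟩
      have h3 := hv.co.1 hb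
      rw [h2, h3, Finset.erase_eq_of_notMem (Finset.notMem_erase _ _)]
      simp
      omega
    · have h2 : ({p.1, p.2} : Finset ν).erase S.o = {p.1, p.2} := by
        apply Finset.erase_eq_of_notMem
        simp only [Finset.mem_insert, Finset.mem_singleton, not_or]
        exact ⟨hv.a_ne.1.symm, Ne.symm hb⟩
      have h3 : S.cc F p.1 ≠ S.cc F S.o := fun h => hb (hv.co.2 h)
      have h4 := Finset.card_erase_add_one (Finset.mem_erase.2 ⟨h3, Finset.mem_univ _⟩)
      rw [h2, Finset.card_pair hv.ne]
      simp
      omega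

theorem z_notMem_V1 {i : Finset ε × Option (ν × ν)} (hi : i ∈ S.Idx) {K : Finset ν}
    (hK : K ∈ S.KV i) : S.z ∉ S.V1 i K := by
  have hi' := (Finset.mem_filter.1 hi).2
  have hg := good_union (good_KV hK) (good_base hi'.2.2)
  intro h
  rcases Finset.mem_union.1 h with h | h
  · exact S.zX (hi'.1 h)
  · obtain ⟨v, hv, hvz⟩ := Finset.mem_image.1 h
    exact S.tz v (hg v hv).1 (hg v hv).2 hvz

/-- Decomposition of an arbitrary edge set avoiding `z`. -/
theorem decomp {A : Finset ε} (hz : S.z ∉ A) : ∃ (F : Finset ε) (Y : Finset ν), F ⊆ S.X ∧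
    S.Good Y ∧ A = F ∪ Y.image S.t := by
  refine ⟨A.filter (· ∈ S.X), Finset.univ.filter fun v => v ≠ S.o ∧ v ≠ S.o' ∧ S.t v ∈ A,
    fun e he => (Finset.mem_filter.1 he).2, ?_, ?_⟩
  · intro y hy
    have := (Finset.mem_filter.1 hy).2
    exact ⟨this.1, this.2.1⟩
  · ext e
    simp only [Finset.mem_union, Finset.mem_filter, Finset.mem_image, Finset.mem_univ, true_and]
    constructor
    · intro he
      rcases S.cover e with rfl | h | ⟨v, h1, h2, rfl⟩
      · exact absurd he hz
      · exact Or.inl ⟨he, h⟩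
      · exact Or.inr ⟨v, ⟨h1, h2, he⟩, rfl⟩
    · rintro (h | ⟨v, ⟨_, _, h⟩, rfl⟩)
      · exact h.1
      · exact h

theorem decomp_unique {F F' : Finset ε} {Y Y' : Finset ν} (hF : F ⊆ S.X) (hF' : F' ⊆ S.X)
    (hY : S.Good Y) (hY' : S.Good Y') (h : F ∪ Y.image S.t = F' ∪ Y'.image S.t) :
    F = F' ∧ Y = Y' := by
  have key : ∀ (F F' : Finset ε) (Y Y' : Finset ν), F ⊆ S.X → F' ⊆ S.X → S.Good Y → S.Good Y' →
      F ∪ Y.image S.t = F' ∪ Y'.image S.t → F ⊆ F' ∧ Y ⊆ Y' := by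
    intro F F' Y Y' hF hF' hY hY' h
    constructor
    · intro e he
      have : e ∈ F' ∪ Y'.image S.t := h ▸ Finset.mem_union_left _ he
      rcases Finset.mem_union.1 this with h | h
      · exact h
      · obtain ⟨v, hv, rfl⟩ := Finset.mem_image.1 h
        exact absurd (hF he) (S.tX v (hY' v hv).1 (hY' v hv).2)
    · intro y hy
      have : S.t y ∈ F' ∪ Y'.image S.t :=
        h ▸ Finset.mem_union_right _ (Finset.mem_image_of_mem _ hy)
      rcases Finset.mem_union.1 this with h | h
      · exact absurd (hF' h) (S.tX y (hY y hy).1 (hY y hy).2)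
      · obtain ⟨v, hv, hvy⟩ := Finset.mem_image.1 h
        exact S.tinj v (hY' v hv).1 (hY' v hv).2 y (hY y hy).1 (hY y hy).2 hvy ▸ hv
  have h1 := key F F' Y Y' hF hF' hY hY' h
  have h2 := key F' F Y' Y hF' hF hY' hY h.symm
  exact ⟨h1.1.antisymm h2.1, h1.2.antisymm h2.2⟩

/-- Acyclic sets to which `z` can be added. -/
theorem acyclic_insert_iff {F : Finset ε} (hF : F ⊆ S.X) (hac : IsAcyclic S.ends F)
    {Y : Finset ν} (hY : S.Good Y) :
    IsAcyclic S.ends (insert S.z (F ∪ Y.image S.t)) ↔ Y ∈ S.KV (F, none) := by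
  rw [← Finset.insert_union, acyclic_iff_with hF hac hY, KV, mem_trans]
  simp only [mem_RR_none, Finset.subset_univ, true_and]

/-- The set `V1` is acyclic for an index with a pair, but `z` cannot be added. -/
theorem V1_some {F : Finset ε} (hF : F ⊆ S.X) (hac : IsAcyclic S.ends F) {p : ν × ν}
    (hp : S.VP F p) {K : Finset ν} (hK : K ∈ S.KV (F, some p)) :
    IsAcyclic S.ends (S.V1 (F, some p) K) ∧
      ¬ IsAcyclic S.ends (insert S.z (S.V1 (F, some p) K)) := by
  have hKg := good_KV hK
  have hbg : S.Good (S.base (some p)) := good_base (F := F) (by rintro q ⟨⟩; exact hp)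
  obtain ⟨-, hKi, hKR⟩ := mem_trans.1 hK
  simp only [mem_RR_some] at hKR
  have hzF : S.z ∉ F := fun h => S.zX (hF h)
  set Y1 : Finset ν := K ∪ ({p.2} : Finset ν).erase S.o with hY1
  have hY1b : ∀ y ∈ Y1, y ∈ K ∨ (y = p.2 ∧ y ≠ S.o) := by
    intro y hy
    simp only [hY1, Finset.mem_union, Finset.mem_erase, Finset.mem_singleton] at hy
    tauto
  have hY1g : S.Good Y1 := by
    intro y hy
    rcases hY1b y hy with h | ⟨rfl, h⟩
    · exact hKg y h
    · exact ⟨h, hp.b_ne h⟩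
  have hY1K : Y1 ∈ S.KV (F, none) := by
    rw [KV, mem_trans]
    refine ⟨Finset.subset_univ _, ?_, ?_⟩
    · intro x hx y hy hxy
      rcases hY1b x hx with h | ⟨rfl, h⟩ <;> rcases hY1b y hy with h' | ⟨rfl, h'⟩
      · exact hKi h h' hxy
      · exact absurd (hxy.trans hp.cb) (hKR x h).1
      · exact absurd (hxy.symm.trans hp.cb) (hKR y h').1
      · rfl
    · intro y hy
      rw [mem_RR_none]
      rcases hY1b y hy with h | ⟨rfl, h⟩
      · exact (hKR y h).2
      · intro hh
        exact h (hp.co.2 (hp.cb.symm.trans hh))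
  have hac1 := (acyclic_insert_iff hF hac hY1g).2 hY1K
  have hV : S.V1 (F, some p) K = insert (S.t p.1) (F ∪ Y1.image S.t) := by
    rw [← Finset.union_insert, ← Finset.image_insert]
    unfold V1
    congr 2
    ext x
    simp only [base, hY1, Finset.mem_union, Finset.mem_erase, Finset.mem_insert,
      Finset.mem_singleton]
    constructor
    · tauto
    · rintro (rfl | h)
      · exact Or.inr ⟨hp.a_ne.1, Or.inl rfl⟩
      · tauto
  have hzA : S.z ∉ F ∪ Y1.image S.t := by
    intro h
    rcases Finset.mem_union.1 h with h | h
    · exact hzF h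
    · obtain ⟨v, hv, hvz⟩ := Finset.mem_image.1 h
      exact S.tz v (hY1g v hv).1 (hY1g v hv).2 hvz
  have hoo := hac1.not_reachable hzA S.hz
  have hta : S.ends (S.t p.1) = s(S.o, p.1) := by
    rw [S.ht _ hp.a_ne.1 hp.a_ne.2, if_pos hp.1]
  have hsub : F ⊆ F ∪ Y1.image S.t := Finset.subset_union_left
  have hao' : Reachable S.ends (F ∪ Y1.image S.t) p.1 S.o' := by
    by_cases hb : p.2 = S.o
    · have := hp.2.2.1
      rw [hb] at this
      exact (reach_o hF hp.a_ne.1 this).mono hsub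
    · have h1 := (reach_drop hF hp.a_ne.1 hb hp.2.2.1).mono hsub
      have h2 := S.ht p.2 hb (hp.b_ne hb)
      rw [if_neg (by rw [hp.2.1]; simp)] at h2
      refine h1.trans (Reachable.edge (e := S.t p.2) ?_ h2).symm
      refine Finset.mem_union_right _ (Finset.mem_image_of_mem _ ?_)
      simp [hY1, hb]
  have hacV : IsAcyclic S.ends (S.V1 (F, some p) K) := by
    rw [hV]
    refine (hac1.mono (Finset.subset_insert _ _)).insert_edge hta ?_
    intro h
    exact hoo (h.trans hao')
  refine ⟨hacV, ?_⟩
  intro hcon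
  have hzV : S.z ∉ S.V1 (F, some p) K := by
    rw [hV, Finset.mem_insert, not_or]
    exact ⟨fun h => S.tz _ hp.a_ne.1 hp.a_ne.2 h.symm, hzA⟩
  refine hcon.not_reachable hzV S.hz ?_
  rw [hV]
  exact (Reachable.edge (Finset.mem_insert_self _ _) hta).trans
    (hao'.mono (Finset.subset_insert _ _))

/-- Every acyclic set to which `z` cannot be added comes from a pair. -/
theorem exists_pair {F : Finset ε} (hF : F ⊆ S.X) {Y : Finset ν} (hY : S.Good Y)
    (hac : IsAcyclic S.ends (F ∪ Y.image S.t))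
    (hn : ¬ IsAcyclic S.ends (insert S.z (F ∪ Y.image S.t))) :
    ∃ p, S.VP F p ∧ ∃ K ∈ S.KV (F, some p), Y = K ∪ S.base (some p) := by
  have hacF : IsAcyclic S.ends F := hac.mono Finset.subset_union_left
  have hr : Reachable S.ends (F ∪ Y.image S.t) S.o S.o' := by
    by_contra h
    exact hn (hac.insert_edge S.hz h)
  obtain ⟨e, heA, hoe, -, hsep⟩ := First.exists hac hr S.hoo
  obtain ⟨a, haY, rfl⟩ : ∃ a ∈ Y, S.t a = e := by
    rcases Finset.mem_union.1 heA with h | h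
    · exact absurd hoe (o_iso hF e h)
    · exact Finset.mem_image.1 h
  have ha := hY a haY
  have hta := S.ht a ha.1 ha.2
  have hsa : S.side a = true := by
    by_contra h
    rw [hta, if_neg h] at hoe
    rcases Sym2.mem_iff.1 hoe with h | h
    · exact S.hoo h
    · exact ha.1 h.symm
  rw [if_pos hsa] at hta
  have hYe : S.Good (Y.erase a) := fun y hy => hY y (Finset.mem_of_mem_erase hy)
  have herase : (F ∪ Y.image S.t).erase (S.t a) = F ∪ (Y.erase a).image S.t := by
    ext e
    simp only [Finset.mem_erase, Finset.mem_union, Finset.mem_image]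
    constructor
    · rintro ⟨h, h' | ⟨y, hy, rfl⟩⟩
      · exact Or.inl h'
      · exact Or.inr ⟨y, ⟨fun hh => h (by rw [hh]), hy⟩, rfl⟩
    · rintro (h | ⟨y, ⟨hya, hy⟩, rfl⟩)
      · exact ⟨fun hh => S.tX a ha.1 ha.2 (hF (hh ▸ h)), Or.inl h⟩
      · exact ⟨fun hh => hya (S.tinj y (hY y hy).1 (hY y hy).2 a ha.1 ha.2 hh),
          Or.inr ⟨y, hy, rfl⟩⟩
  have hacE : IsAcyclic S.ends (F ∪ (Y.erase a).image S.t) := by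
    rw [← herase]; exact hac.mono (Finset.erase_subset _ _)
  rw [herase] at hsep
  have hKE := (acyclic_insert_iff hF hacF hYe).1 (hacE.insert_edge S.hz hsep)
  obtain ⟨-, hinj, hRR⟩ := mem_trans.1 hKE
  simp only [mem_RR_none] at hRR
  have hYa : insert a (Y.erase a) = Y := Finset.insert_erase haY
  by_cases hc : S.cc F a = S.cc F S.o
  · refine ⟨(a, S.o), ⟨hsa, S.so, cq_eq.1 hc, Or.inl rfl⟩, Y.erase a, ?_, ?_⟩
    · rw [KV, mem_trans]
      refine ⟨Finset.subset_univ _, hinj, fun y hy => ?_⟩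
      rw [mem_RR_some]
      exact ⟨by rw [hc]; exact hRR y hy, hRR y hy⟩
    · ext x
      simp only [base, Finset.mem_union, Finset.mem_erase, Finset.mem_insert, Finset.mem_singleton]
      constructor
      · intro hx
        by_cases hxa : x = a
        · exact Or.inr ⟨(hY x hx).1, Or.inl hxa⟩
        · exact Or.inl ⟨hxa, hx⟩
      · rintro (h | ⟨h, rfl | h'⟩)
        · exact h.2
        · exact haY
        · exact absurd h' h
  · obtain ⟨b, hb, hbc⟩ : ∃ b ∈ Y.erase a, S.cc F b = S.cc F a := by
      by_contra hcon
      push Not at hcon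
      apply hn
      rw [acyclic_insert_iff hF hacF hY, KV, mem_trans]
      refine ⟨Finset.subset_univ _, ?_, ?_⟩
      · rw [← hYa, Finset.coe_insert, Set.injOn_insert (by simp)]
        refine ⟨hinj, ?_⟩
        rintro ⟨b, hb, hbc⟩
        exact hcon b hb hbc
      · intro y hy
        rw [mem_RR_none]
        rw [← hYa, Finset.mem_insert] at hy
        rcases hy with rfl | hy
        · exact hc
        · exact hRR y hy
    have hbY := Finset.mem_of_mem_erase hb
    have hbg := hY b hbY
    have hab : Reachable S.ends F a b := reach_drop hF ha.1 hbg.1 (cq_eq.1 hbc).symm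
    have hsb : S.side b = false := by
      by_contra hsb
      have htb := S.ht b hbg.1 hbg.2
      rw [if_pos (by simpa using hsb)] at htb
      refine hac (S.t a) heA S.o a hta ?_
      rw [herase]
      refine (Reachable.edge (e := S.t b) ?_ htb).trans (hab.symm.mono Finset.subset_union_left)
      exact Finset.mem_union_right _ (Finset.mem_image_of_mem _ hb)
    refine ⟨(a, b), ⟨hsa, hsb, (cq_eq.1 hbc).symm, Or.inr fun h => hc (cq_eq.2 h)⟩,
      (Y.erase a).erase b, ?_, ?_⟩
    · rw [KV, mem_trans]
      refine ⟨Finset.subset_univ _,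
        hinj.mono (Finset.coe_subset.2 (Finset.erase_subset _ _)), fun y hy => ?_⟩
      rw [mem_RR_some]
      have hy' := Finset.mem_of_mem_erase hy
      exact ⟨fun h => Finset.ne_of_mem_erase hy (hinj hy' hb (h.trans hbc.symm)), hRR y hy'⟩
    · ext x
      simp only [base, Finset.mem_union, Finset.mem_erase, Finset.mem_insert, Finset.mem_singleton]
      constructor
      · intro hx
        by_cases hxa : x = a
        · exact Or.inr ⟨(hY x hx).1, Or.inl hxa⟩
        · by_cases hxb : x = b
          · exact Or.inr ⟨(hY x hx).1, Or.inr hxb⟩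
          · exact Or.inl ⟨hxb, hxa, hx⟩
      · rintro (h | ⟨h, rfl | rfl⟩)
        · exact h.2.2
        · exact haY
        · exact hbY

theorem pair_unique {F : Finset ε} {p p' : ν × ν} (hp : S.VP F p) (hp' : S.VP F p')
    {K K' : Finset ν} (hK : K ∈ S.KV (F, some p)) (hK' : K' ∈ S.KV (F, some p'))
    (h : K ∪ S.base (some p) = K' ∪ S.base (some p')) : p = p' ∧ K = K' := by
  have hd := disj_base (F := F) (p := some p) (by rintro q ⟨⟩; exact hp) hK
  have hd' := disj_base (F := F) (p := some p') (by rintro q ⟨⟩; exact hp') hK'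
  obtain ⟨-, hKi', hKR'⟩ := mem_trans.1 hK'
  simp only [mem_RR_some] at hKR'
  have hmem : ∀ x, x ≠ S.o → (x = p.1 ∨ x = p.2) → x ∈ K' ∨ x = p'.1 ∨ x = p'.2 := by
    intro x hx hxp
    have : x ∈ K' ∪ S.base (some p') := by
      rw [← h]
      simp only [base, Finset.mem_union, Finset.mem_erase, Finset.mem_insert, Finset.mem_singleton]
      exact Or.inr ⟨hx, hxp⟩
    simp only [base, Finset.mem_union, Finset.mem_erase, Finset.mem_insert,
      Finset.mem_singleton] at this
    tauto
  have hss : ∀ x y : ν, S.side x = true → S.side y = false → x ≠ y := by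
    rintro x y hx hy rfl
    rw [hx] at hy
    exact Bool.noConfusion hy
  have ha : p.1 = p'.1 := by
    rcases hmem p.1 hp.a_ne.1 (Or.inl rfl) with h1 | h1 | h1
    · exfalso
      have h2 := hKR' _ h1
      have hbo : p.2 ≠ S.o := fun hh => h2.2 (hp.co.1 hh)
      rcases hmem p.2 hbo (Or.inr rfl) with h3 | h3 | h3
      · exact hp.ne (hKi' h1 h3 hp.cb.symm)
      · exact hss _ _ hp'.1 hp.2.1 h3.symm
      · apply h2.1
        rw [← hp.cb, h3, hp'.cb]
    · exact h1
    · exact absurd h1 (hss _ _ hp.1 hp'.2.1)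
  have hb : p.2 = p'.2 := by
    by_cases hbo : p.2 = S.o
    · rw [hbo]
      have := hp.co.1 hbo
      rw [ha] at this
      exact (hp'.co.2 this).symm
    · rcases hmem p.2 hbo (Or.inr rfl) with h3 | h3 | h3
      · exact absurd (by rw [hp.cb, ha]) (hKR' _ h3).1
      · exact absurd h3.symm (hss _ _ hp'.1 hp.2.1)
      · exact h3
  have hpp : p = p' := Prod.ext ha hb
  subst hpp
  refine ⟨rfl, ?_⟩
  rw [← Finset.union_sdiff_cancel_right hd, ← Finset.union_sdiff_cancel_right hd', h]

end Setup

namespace Setup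
variable {ε ν : Type} [DecidableEq ε] [Fintype ε] [Fintype ν] {S : Setup ε ν}

theorem V1_none_eq (F : Finset ε) (K : Finset ν) : S.V1 (F, none) K = F ∪ K.image S.t := by
  simp [V1, base]

theorem mem_idx {i : Finset ε × Option (ν × ν)} : i ∈ S.Idx ↔
    i.1 ⊆ S.X ∧ IsAcyclic S.ends i.1 ∧ ∀ p, i.2 = some p → S.VP i.1 p := by
  simp [Idx]

theorem V1_none {F : Finset ε} (hF : F ⊆ S.X) (hac : IsAcyclic S.ends F) {K : Finset ν}
    (hK : K ∈ S.KV (F, none)) : IsAcyclic S.ends (insert S.z (S.V1 (F, none) K)) := by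
  rw [V1_none_eq]
  exact (acyclic_insert_iff hF hac (good_KV hK)).2 hK

theorem V1_acyclic {i : Finset ε × Option (ν × ν)} (hi : i ∈ S.Idx) {K : Finset ν}
    (hK : K ∈ S.KV i) : IsAcyclic S.ends (S.V1 i K) := by
  obtain ⟨F, p⟩ := i
  obtain ⟨h1, h2, h3⟩ := mem_idx.1 hi
  cases p with
  | none => exact (V1_none h1 h2 hK).mono (Finset.subset_insert _ _)
  | some p => exact (V1_some h1 h2 (h3 p rfl) hK).1

theorem V1_inj {i j : Finset ε × Option (ν × ν)} (hi : i ∈ S.Idx) (hj : j ∈ S.Idx)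
    {K L : Finset ν} (hK : K ∈ S.KV i) (hL : L ∈ S.KV j) (h : S.V1 i K = S.V1 j L) :
    i = j ∧ K = L := by
  obtain ⟨F, p⟩ := i
  obtain ⟨F', p'⟩ := j
  obtain ⟨h1, h2, h3⟩ := mem_idx.1 hi
  obtain ⟨h1', h2', h3'⟩ := mem_idx.1 hj
  obtain ⟨hF, hY⟩ := decomp_unique h1 h1' (good_union (good_KV hK) (good_base h3))
    (good_union (good_KV hL) (good_base h3')) h
  simp only at hF hY
  subst hF
  cases p with
  | none =>
    cases p' with
    | none => simpa [base] using hY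
    | some p' =>
      refine absurd (V1_none h1 h2 hK) ?_
      rw [h]
      exact (V1_some h1' h2' (h3' p' rfl) hL).2
  | some p =>
    cases p' with
    | none =>
      refine absurd (V1_none h1' h2' hL) ?_
      rw [← h]
      exact (V1_some h1 h2 (h3 p rfl) hK).2
    | some p' =>
      obtain ⟨rfl, rfl⟩ := pair_unique (h3 p rfl) (h3' p' rfl) hK hL hY
      exact ⟨rfl, rfl⟩

theorem sum_out {R : Type} [CommSemiring R] (f : Finset ε → R) :
    ∑ A ∈ (Finset.univ.filter fun A => IsAcyclic S.ends A).filter (fun A => ¬ S.z ∈ A), f A =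
      ∑ i ∈ S.Idx, ∑ K ∈ S.KV i, f (S.V1 i K) := by
  rw [Finset.sum_sigma']
  symm
  refine Finset.sum_bij (fun x _ => S.V1 x.1 x.2) ?_ ?_ ?_ ?_
  · rintro ⟨i, K⟩ hx
    obtain ⟨hi, hK⟩ := Finset.mem_sigma.1 hx
    simp only [Finset.mem_filter, Finset.mem_univ, true_and]
    exact ⟨V1_acyclic hi hK, z_notMem_V1 hi hK⟩
  · rintro ⟨i, K⟩ hx ⟨j, L⟩ hy h
    obtain ⟨hi, hK⟩ := Finset.mem_sigma.1 hx
    obtain ⟨hj, hL⟩ := Finset.mem_sigma.1 hy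
    obtain ⟨rfl, rfl⟩ := V1_inj hi hj hK hL h
    rfl
  · intro A hA
    simp only [Finset.mem_filter, Finset.mem_univ, true_and] at hA
    obtain ⟨F, Y, hF, hY, rfl⟩ := decomp hA.2
    have hac : IsAcyclic S.ends F := hA.1.mono Finset.subset_union_left
    by_cases hz : IsAcyclic S.ends (insert S.z (F ∪ Y.image S.t))
    · refine ⟨⟨(F, none), Y⟩, ?_, V1_none_eq F Y⟩
      rw [Finset.mem_sigma]
      exact ⟨mem_idx.2 ⟨hF, hac, by simp⟩, (acyclic_insert_iff hF hac hY).1 hz⟩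
    · obtain ⟨p, hp, K, hK, rfl⟩ := exists_pair hF hY hA.1 hz
      refine ⟨⟨(F, some p), K⟩, ?_, rfl⟩
      rw [Finset.mem_sigma]
      refine ⟨mem_idx.2 ⟨hF, hac, ?_⟩, hK⟩
      rintro q ⟨⟩
      exact hp
  · intros
    rfl

theorem sum_in {R : Type} [CommSemiring R] (f : Finset ε → R) :
    ∑ A ∈ (Finset.univ.filter fun A => IsAcyclic S.ends A).filter (fun A => S.z ∈ A), f A =
      ∑ i ∈ S.Idx, if i.2 = none then ∑ K ∈ S.KV i, f (insert S.z (S.V1 i K)) else 0 := by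
  rw [← Finset.sum_filter, Finset.sum_sigma']
  symm
  refine Finset.sum_bij (fun x _ => insert S.z (S.V1 x.1 x.2)) ?_ ?_ ?_ ?_
  · rintro ⟨⟨F, p⟩, K⟩ hx
    obtain ⟨hi, hK⟩ := Finset.mem_sigma.1 hx
    obtain ⟨hi, hp⟩ := Finset.mem_filter.1 hi
    simp only at hp
    subst hp
    obtain ⟨h1, h2, h3⟩ := mem_idx.1 hi
    simp only [Finset.mem_filter, Finset.mem_univ, true_and]
    exact ⟨V1_none h1 h2 hK, Finset.mem_insert_self _ _⟩
  · rintro ⟨i, K⟩ hx ⟨j, L⟩ hy h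
    obtain ⟨hi, hK⟩ := Finset.mem_sigma.1 hx
    obtain ⟨hj, hL⟩ := Finset.mem_sigma.1 hy
    have hi := (Finset.mem_filter.1 hi).1
    have hj := (Finset.mem_filter.1 hj).1
    simp only at h
    have h' : S.V1 i K = S.V1 j L := by
      rw [← Finset.erase_insert (z_notMem_V1 hi hK), ← Finset.erase_insert (z_notMem_V1 hj hL), h]
    obtain ⟨rfl, rfl⟩ := V1_inj hi hj hK hL h'
    rfl
  · intro A hA
    simp only [Finset.mem_filter, Finset.mem_univ, true_and] at hA
    obtain ⟨F, Y, hF, hY, hAe⟩ := decomp (S := S) (Finset.notMem_erase S.z A)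
    have hA' : A = insert S.z (F ∪ Y.image S.t) := by rw [← hAe, Finset.insert_erase hA.2]
    have hac : IsAcyclic S.ends F := hA.1.mono (by
      rw [hA']
      exact Finset.subset_union_left.trans (Finset.subset_insert _ _))
    have hz := hA.1
    rw [hA'] at hz
    refine ⟨⟨(F, none), Y⟩, ?_, ?_⟩
    · rw [Finset.mem_sigma]
      exact ⟨Finset.mem_filter.2 ⟨mem_idx.2 ⟨hF, hac, by simp⟩, rfl⟩,
        (acyclic_insert_iff hF hac hY).1 hz⟩
    · rw [hA', V1_none_eq]
  · intros
    rfl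

theorem sum_acyclic {R : Type} [CommSemiring R] (t : R) {d : ℕ} (hd : d + 1 = Fintype.card ν) :
    ∑ A ∈ Finset.univ.filter (fun A => IsAcyclic S.ends A), t ^ (d - A.card) =
      ∑ i ∈ S.Idx, ∑ K ∈ S.KE i, (t + 1) ^ ((S.RR i.1 i.2).card - K.card + dl i.2) := by
  rw [← Finset.sum_filter_add_sum_filter_not _ (fun A => S.z ∈ A), sum_in, sum_out,
    ← Finset.sum_add_distrib]
  refine Finset.sum_congr rfl fun i hi => ?_
  have hR := card_RR hi
  simp only [pow_add]
  rw [← Finset.sum_mul, ← sum_KV_eq_sum_KE hi]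
  have h1 : ∀ K ∈ S.KV i, d - (S.V1 i K).card = (S.RR i.1 i.2).card - K.card + dl i.2 := by
    intro K hK
    have := card_V1 hi hK
    have := card_le_of_mem_trans hK
    omega
  have h2 : ∀ K ∈ S.KV i, i.2 = none →
      d - (insert S.z (S.V1 i K)).card = (S.RR i.1 i.2).card - K.card := by
    intro K hK hn
    rw [Finset.card_insert_of_notMem (z_notMem_V1 hi hK)]
    have := card_V1 hi hK
    have := card_le_of_mem_trans hK
    have h3 : dl i.2 = 1 := by simp [dl, hn]
    omega
  by_cases hn : i.2 = none
  · have h3 : dl i.2 = 1 := by simp [dl, hn]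
    rw [if_pos hn, Finset.sum_mul, ← Finset.sum_add_distrib]
    refine Finset.sum_congr rfl fun K hK => ?_
    rw [h1 K hK, h2 K hK hn, h3]
    ring
  · have h3 : dl i.2 = 0 := by simp [dl, hn]
    rw [if_neg hn, zero_add, h3, pow_zero, mul_one]
    refine Finset.sum_congr rfl fun K hK => ?_
    rw [h1 K hK, h3, add_zero]

end Setup

namespace Setup
variable {ε ν : Type} [DecidableEq ε] [Fintype ε] [Fintype ν] (S : Setup ε ν)

/-- The first edge of the path from `a` to `b`. -/
def phi (F : Finset ε) (a b : ν) : ε :=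
  if h : ∃ e, First S.ends (insert S.z F) a b e then h.choose else S.z

/-- The edge roots of the distinguished pair. -/
def bE (F : Finset ε) : Option (ν × ν) → Multiset ε
  | none => 0
  | some p => if p.2 = S.o then {S.phi F p.1 p.2} else {S.phi F p.1 p.2, S.phi F p.2 p.1}

/-- The multiset belonging to an index and an edge choice. -/
def E1 (i : Finset ε × Option (ν × ν)) (K : Finset ε) : Multiset ε :=
  i.1.val + (K.val + S.bE i.1 i.2)

/-- The multicomplex. -/
def MC (μ : Multiset ε) : Prop := Del S.ends S.side (insert S.z S.X) (S.z ::ₘ S.z ::ₘ μ)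

variable {S}

theorem phi_spec {F : Finset ε} (hac : IsAcyclic S.ends (insert S.z F)) {a b : ν} (hne : a ≠ b)
    (h : Reachable S.ends (insert S.z F) a b) :
    First S.ends (insert S.z F) a b (S.phi F a b) := by
  have := First.exists hac h hne
  rw [phi, dif_pos this]
  exact this.choose_spec

theorem phi_eq {F : Finset ε} (hac : IsAcyclic S.ends (insert S.z F)) {a b : ν} {e : ε}
    (h : First S.ends (insert S.z F) a b e) : S.phi F a b = e :=
  First.unique hac (phi_spec hac h.ne h.2.2.1) h

theorem VP.phi1 {F : Finset ε} (hF : F ⊆ S.X) (hac : IsAcyclic S.ends F) {p : ν × ν}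
    (hp : S.VP F p) : First S.ends (insert S.z F) p.1 p.2 (S.phi F p.1 p.2) :=
  phi_spec (acyclic_z hF hac) hp.ne hp.2.2.1

theorem VP.phi2 {F : Finset ε} (hF : F ⊆ S.X) (hac : IsAcyclic S.ends F) {p : ν × ν}
    (hp : S.VP F p) : First S.ends (insert S.z F) p.2 p.1 (S.phi F p.2 p.1) :=
  phi_spec (acyclic_z hF hac) hp.ne.symm hp.2.2.1.symm

theorem ec_z (F : Finset ε) : S.cc F (ec S.ends S.z) = S.cc F S.o :=
  cq_eq.2 (ec_reach (Finset.mem_insert_self _ _) (by rw [S.hz]; simp))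

theorem mem_KE {i : Finset ε × Option (ν × ν)} {K : Finset ε} (hK : K ∈ S.KE i) :
    K ⊆ i.1 := by
  intro e he
  obtain ⟨h1, _, h3⟩ := mem_trans.1 hK
  refine (Finset.mem_insert.1 (h1 he)).resolve_left ?_
  rintro rfl
  have := h3 _ he
  rw [ec_z] at this
  exact RR_avoid_o this

theorem card_bE {F : Finset ε} {p : Option (ν × ν)} (hp : ∀ q, p = some q → S.VP F q) :
    Multiset.card (S.bE F p) = (S.base p).card := by
  cases p with
  | none => simp [bE, base]
  | some p =>
    have hv := hp p rfl
    by_cases hb : p.2 = S.o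
    · have : ({p.1, p.2} : Finset ν).erase S.o = {p.1} := by
        ext x
        simp only [Finset.mem_erase, Finset.mem_insert, Finset.mem_singleton]
        constructor
        · rintro ⟨h, rfl | rfl⟩
          · rfl
          · exact absurd hb h
        · rintro rfl
          exact ⟨hv.a_ne.1, Or.inl rfl⟩
      simp only [bE, base, if_pos hb, this]
      simp
    · have : ({p.1, p.2} : Finset ν).erase S.o = {p.1, p.2} := by
        apply Finset.erase_eq_of_notMem
        simp only [Finset.mem_insert, Finset.mem_singleton, not_or]
        exact ⟨hv.a_ne.1.symm, Ne.symm hb⟩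
      simp only [bE, base, if_neg hb, this, Finset.card_pair hv.ne]
      simp

theorem pw_KE {i : Finset ε × Option (ν × ν)} {K : Finset ε} (hK : K ∈ S.KE i) :
    Pw S.ends (insert S.z i.1) K := by
  obtain ⟨h1, h2, h3⟩ := mem_trans.1 hK
  exact ⟨h1, fun e he f hf h => h2 he hf (cq_eq.2 h)⟩

theorem pw_insert {i : Finset ε × Option (ν × ν)} {K : Finset ε} (hK : K ∈ S.KE i) :
    Pw S.ends (insert S.z i.1) (insert S.z K) := by
  refine (pw_KE hK).insert_of (Finset.mem_insert_self _ _) ?_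
  intro k hk h
  obtain ⟨h1, h2, h3⟩ := mem_trans.1 hK
  have := h3 k hk
  rw [show S.cc i.1 (ec S.ends k) = S.cc i.1 S.o from (cq_eq.2 h).trans (ec_z _)] at this
  exact RR_avoid_o this

theorem z_notMem {F : Finset ε} (hF : F ⊆ S.X) : S.z ∉ F := fun h => S.zX (hF h)

theorem E1_mem {i : Finset ε × Option (ν × ν)} (hi : i ∈ S.Idx) {K : Finset ε}
    (hK : K ∈ S.KE i) : S.MC (S.E1 i K) := by
  obtain ⟨F, p⟩ := i
  obtain ⟨hF, hac, hp⟩ := mem_idx.1 hi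
  have hzF := z_notMem hF
  have hKF := mem_KE hK
  have hzK : S.z ∉ K := fun h => hzF (hKF h)
  refine ⟨insert S.z F, S.z ::ₘ (K.val + S.bE F p), ?_, Finset.insert_subset_insert _ hF,
    acyclic_z hF hac, ?_⟩
  · rw [Finset.insert_val_of_notMem hzF, E1]
    simp
  cases p with
  | none =>
    left
    refine ⟨insert S.z K, ?_, pw_insert hK⟩
    rw [Finset.insert_val_of_notMem hzK]
    simp [bE]
  | some p =>
    right
    have hv := hp p rfl
    have hRR : ∀ k ∈ K, ¬ Reachable S.ends (insert S.z F) (ec S.ends k) p.1 := by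
      intro k hk h
      exact (mem_RR_some.1 ((mem_trans.1 hK).2.2 k hk)).1 (cq_eq.2 h)
    have hs : S.side p.1 ≠ S.side p.2 := by
      rw [hv.1, hv.2.1]
      simp
    have h1 := hv.phi1 hF hac
    by_cases hb : p.2 = S.o
    · refine ⟨p.1, p.2, S.phi F p.1 p.2, S.z, K, ?_, hs, h1, ?_, pw_KE hK, hRR⟩
      · simp only [bE, if_pos hb]
        rw [Multiset.cons_swap, add_comm, Multiset.singleton_add]
      · refine ⟨Finset.mem_insert_self _ _, by rw [S.hz, hb]; simp, hv.2.2.1.symm, ?_⟩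
        rw [Finset.erase_insert hzF, hb]
        intro h
        exact hv.a_ne.1 (isolated_reach (o_iso hF) h.symm)
    · refine ⟨p.1, p.2, S.phi F p.1 p.2, S.phi F p.2 p.1, insert S.z K, ?_, hs, h1,
        hv.phi2 hF hac, pw_insert hK, ?_⟩
      · simp only [bE, if_neg hb]
        rw [Finset.insert_val_of_notMem hzK]
        ext x
        simp only [Multiset.insert_eq_cons, Multiset.count_cons, Multiset.count_add,
          Multiset.count_singleton]
        ring
      · intro k hk h
        rcases Finset.mem_insert.1 hk with rfl | hk
        · exact hb (hv.co.2 ((cq_eq.2 h).symm.trans (ec_z F)))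
        · exact hRR k hk h

theorem ty2_wlog {F : Finset ε} {ρ : Multiset ε} (h : Ty2 S.ends S.side F ρ) :
    ∃ (a b : ν) (e f : ε) (K : Finset ε), ρ = e ::ₘ f ::ₘ K.val ∧ S.side a = true ∧
      S.side b = false ∧ First S.ends F a b e ∧ First S.ends F b a f ∧ Pw S.ends F K ∧
      ∀ k ∈ K, ¬ Reachable S.ends F (ec S.ends k) a := by
  obtain ⟨a, b, e, f, K, rfl, hs, h1, h2, hK, hKa⟩ := h
  cases ha : S.side a with
  | true =>
    refine ⟨a, b, e, f, K, rfl, ha, ?_, h1, h2, hK, hKa⟩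
    cases hb : S.side b with
    | true => rw [ha, hb] at hs; exact absurd rfl hs
    | false => rfl
  | false =>
    refine ⟨b, a, f, e, K, Multiset.cons_swap _ _ _, ?_, ha, h2, h1, hK,
      fun k hk h => hKa k hk (h.trans h2.2.2.1)⟩
    cases hb : S.side b with
    | true => rfl
    | false => rw [ha, hb] at hs; exact absurd rfl hs

theorem E1_surj {μ : Multiset ε} (h : S.MC μ) : ∃ i ∈ S.Idx, ∃ K ∈ S.KE i, S.E1 i K = μ := by
  obtain ⟨F', ρ, hμ, hF', hac', hty⟩ := h
  have hzρ : S.z ∈ ρ := by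
    by_contra hz
    have h1 := congrArg (Multiset.count S.z) hμ
    rw [Multiset.count_add, Multiset.count_eq_zero_of_notMem hz] at h1
    have h2 := Multiset.nodup_iff_count_le_one.1 F'.nodup S.z
    simp only [Multiset.count_cons_self] at h1
    omega
  have hzF' := ty_sub hty _ hzρ
  obtain ⟨σ, rfl⟩ := Multiset.exists_cons_of_mem hzρ
  obtain ⟨F, hzF, rfl⟩ : ∃ F, S.z ∉ F ∧ insert S.z F = F' :=
    ⟨F'.erase S.z, Finset.notMem_erase _ _, Finset.insert_erase hzF'⟩
  have hF : F ⊆ S.X := by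
    intro e he
    refine (Finset.mem_insert.1 (hF' (Finset.mem_insert_of_mem he))).resolve_left ?_
    rintro rfl
    exact hzF he
  have hac : IsAcyclic S.ends F := hac'.mono (Finset.subset_insert _ _)
  have hμ' : μ = F.val + σ := by
    rw [Finset.insert_val_of_notMem hzF, Multiset.cons_add, Multiset.add_cons] at hμ
    exact (Multiset.cons_inj_right _).1 ((Multiset.cons_inj_right _).1 hμ)
  subst hμ'
  have hPz : ∀ K', Pw S.ends (insert S.z F) K' → S.z ∈ K' → ∀ k ∈ K'.erase S.z,
      S.cc F (ec S.ends k) ≠ S.cc F S.o := by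
    intro K' hP hz k hk hh
    rw [← ec_z F] at hh
    exact Finset.ne_of_mem_erase hk (hP.2 k (Finset.mem_of_mem_erase hk) _ hz (cq_eq.1 hh))
  have hPi : ∀ K', Pw S.ends (insert S.z F) K' →
      Set.InjOn (fun e => S.cc F (ec S.ends e)) K' := by
    intro K' hP x hx y hy hxy
    exact hP.2 x hx y hy (cq_eq.1 hxy)
  rcases hty with ⟨K', hK', hP⟩ | hty
  · have hzK : S.z ∈ K' := by
      rw [← Finset.mem_val, ← hK']
      exact Multiset.mem_cons_self _ _
    refine ⟨(F, none), mem_idx.2 ⟨hF, hac, by simp⟩, K'.erase S.z, ?_, ?_⟩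
    · rw [KE, mem_trans]
      refine ⟨(Finset.erase_subset _ _).trans hP.1,
        hPi _ (hP.subset (Finset.erase_subset _ _)), fun k hk => ?_⟩
      rw [mem_RR_none]
      exact hPz K' hP hzK k hk
    · rw [E1, Finset.erase_val, ← hK', Multiset.erase_cons_head]
      simp [bE]
  · obtain ⟨a, b, e, f, K', hρ, ha, hb, h1, h2, hP, hKa⟩ := ty2_wlog hty
    have hao : a ≠ S.o := by rintro rfl; rw [S.so] at ha; exact Bool.noConfusion ha
    have hao' : a ≠ S.o' := by rintro rfl; rw [S.so'] at ha; exact Bool.noConfusion ha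
    by_cases hzK : S.z ∈ K'
    · have hbo : b ≠ S.o := by
        rintro rfl
        exact hKa _ hzK ((cq_eq.1 (ec_z F)).trans h2.2.2.1)
      have hVP : S.VP F (a, b) := by
        refine ⟨ha, hb, h1.2.2.1, Or.inr fun h => ?_⟩
        exact hKa _ hzK ((cq_eq.1 (ec_z F)).trans h.symm)
      refine ⟨(F, some (a, b)), mem_idx.2 ⟨hF, hac, ?_⟩, K'.erase S.z, ?_, ?_⟩
      · rintro q ⟨⟩
        exact hVP
      · rw [KE, mem_trans]
        refine ⟨(Finset.erase_subset _ _).trans hP.1,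
          hPi _ (hP.subset (Finset.erase_subset _ _)), fun k hk => ?_⟩
        rw [mem_RR_some]
        exact ⟨fun h => hKa k (Finset.mem_of_mem_erase hk) (cq_eq.1 h), hPz K' hP hzK k hk⟩
      · simp only [E1, bE, if_neg hbo, phi_eq hac' h1, phi_eq hac' h2]
        congr 1
        have h3 : K'.val = S.z ::ₘ (K'.erase S.z).val := by
          rw [Finset.erase_val, Multiset.cons_erase (by simpa using hzK)]
        rw [h3] at hρ
        have h4 : S.z ::ₘ σ = S.z ::ₘ ((K'.erase S.z).val + {e, f}) := by
          rw [hρ]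
          ext x
          simp only [Multiset.insert_eq_cons, Multiset.count_cons, Multiset.count_add,
            Multiset.count_singleton]
          ring
        exact ((Multiset.cons_inj_right _).1 h4).symm
    · have hze : e ≠ S.z := by
        rintro rfl
        have := h1.2.1
        rw [S.hz] at this
        rcases Sym2.mem_iff.1 this with h | h
        · exact hao h
        · exact hao' h
      have hzf : f = S.z := by
        have : S.z ∈ e ::ₘ f ::ₘ K'.val := hρ ▸ Multiset.mem_cons_self _ _
        simp only [Multiset.mem_cons, Finset.mem_val] at this
        rcases this with h | h | h
        · exact absurd h.symm hze
        · exact h.symm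
        · exact absurd h hzK
      subst hzf
      have hbo : b = S.o := by
        have := h2.2.1
        rw [S.hz] at this
        rcases Sym2.mem_iff.1 this with h | h
        · exact h
        · exfalso
          subst h
          apply h2.2.2.2
          rw [Finset.erase_insert hzF]
          exact reach_drop hF S.hoo.symm hao h2.2.2.1
      subst hbo
      have hVP : S.VP F (a, S.o) := ⟨ha, hb, h1.2.2.1, Or.inl rfl⟩
      refine ⟨(F, some (a, S.o)), mem_idx.2 ⟨hF, hac, ?_⟩, K', ?_, ?_⟩
      · rintro q ⟨⟩
        exact hVP
      · rw [KE, mem_trans]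
        refine ⟨hP.1, hPi _ hP, fun k hk => ?_⟩
        rw [mem_RR_some]
        exact ⟨fun h => hKa k hk (cq_eq.1 h),
          fun h => hKa k hk ((cq_eq.1 h).trans h2.2.2.1)⟩
      · simp only [E1, bE, if_true, phi_eq hac' h1]
        congr 1
        rw [Multiset.cons_swap] at hρ
        rw [(Multiset.cons_inj_right _).1 hρ, add_comm, Multiset.singleton_add]

end Setup

namespace Setup
variable {ε ν : Type} [DecidableEq ε] [Fintype ε] [Fintype ν] {S : Setup ε ν}

theorem bE_cc {F : Finset ε} (hF : F ⊆ S.X) (hac : IsAcyclic S.ends F) {p : ν × ν}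
    (hp : S.VP F p) : ∀ e ∈ S.bE F (some p), S.cc F (ec S.ends e) = S.cc F p.1 := by
  have h1 : S.cc F (ec S.ends (S.phi F p.1 p.2)) = S.cc F p.1 := cq_eq.2 (hp.phi1 hF hac).ec_right
  have h2 : S.cc F (ec S.ends (S.phi F p.2 p.1)) = S.cc F p.1 :=
    (cq_eq.2 (hp.phi2 hF hac).ec_right).trans hp.cb
  intro e he
  simp only [bE] at he
  split at he
  · rw [Multiset.mem_singleton] at he
    rw [he, h1]
  · simp only [Multiset.insert_eq_cons, Multiset.mem_cons, Multiset.mem_singleton] at he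
    rcases he with rfl | rfl
    · exact h1
    · exact h2

theorem bE_mem {F : Finset ε} (hF : F ⊆ S.X) (hac : IsAcyclic S.ends F) {p : Option (ν × ν)}
    (hp : ∀ q, p = some q → S.VP F q) : ∀ e ∈ S.bE F p, e ∈ F := by
  intro e he
  cases p with
  | none => simp [bE] at he
  | some p =>
    have hv := hp p rfl
    have h1 := hv.phi1 hF hac
    have h2 := hv.phi2 hF hac
    have hez : e ≠ S.z := by
      rintro rfl
      have hc := bE_cc hF hac hv _ he
      rw [ec_z] at hc
      have hb := hv.co.2 hc.symm
      simp only [bE, if_pos hb, Multiset.mem_singleton] at he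
      have h3 := h1.2.1
      rw [← he, S.hz] at h3
      rcases Sym2.mem_iff.1 h3 with h | h
      · exact hv.a_ne.1 h
      · exact hv.a_ne.2 h
    have heF : e ∈ insert S.z F := by
      simp only [bE] at he
      split at he
      · rw [Multiset.mem_singleton] at he
        rw [he]
        exact h1.1
      · simp only [Multiset.insert_eq_cons, Multiset.mem_cons, Multiset.mem_singleton] at he
        rcases he with rfl | rfl
        · exact h1.1
        · exact h2.1
    exact (Finset.mem_insert.1 heF).resolve_left hez

theorem card_bE_some {F : Finset ε} {p : ν × ν} :
    Multiset.card (S.bE F (some p)) = if p.2 = S.o then 1 else 2 := by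
  simp only [bE]
  split <;> simp

/-- The part of a multiset in one component. -/
def fl (S : Setup ε ν) (F : Finset ε) (q : Cmp S.ends (insert S.z F)) (μ : Multiset ε) :
    Multiset ε := μ.filter fun e => S.cc F (ec S.ends e) = q

theorem fl_KE_zero {i : Finset ε × Option (ν × ν)} {K : Finset ε} (hK : K ∈ S.KE i)
    {q : Cmp S.ends (insert S.z i.1)} (hq : q ∉ S.RR i.1 i.2) : S.fl i.1 q K.val = 0 := by
  rw [fl, Multiset.filter_eq_nil]
  intro e he h
  exact hq (h ▸ (mem_trans.1 hK).2.2 e he)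

theorem fl_KE_le {i : Finset ε × Option (ν × ν)} {K : Finset ε} (hK : K ∈ S.KE i)
    (q : Cmp S.ends (insert S.z i.1)) : Multiset.card (S.fl i.1 q K.val) ≤ 1 := by
  rw [fl, ← Finset.filter_val, Finset.card_val, Finset.card_le_one]
  intro a ha b hb
  rw [Finset.mem_filter] at ha hb
  exact (mem_trans.1 hK).2.1 ha.1 hb.1 (ha.2.trans hb.2.symm)

theorem fl_bE {F : Finset ε} (hF : F ⊆ S.X) (hac : IsAcyclic S.ends F) {p : ν × ν}
    (hp : S.VP F p) : S.fl F (S.cc F p.1) (S.bE F (some p)) = S.bE F (some p) := by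
  rw [fl, Multiset.filter_eq_self]
  exact bE_cc hF hac hp

theorem fl_bE_ne {F : Finset ε} (hF : F ⊆ S.X) (hac : IsAcyclic S.ends F) {p : ν × ν}
    (hp : S.VP F p) {q : Cmp S.ends (insert S.z F)} (hq : S.cc F p.1 ≠ q) :
    S.fl F q (S.bE F (some p)) = 0 := by
  rw [fl, Multiset.filter_eq_nil]
  intro e he h
  exact hq ((bE_cc hF hac hp e he).symm.trans h)

/-- The component of the pair cannot be imitated by single roots. -/
theorem no_imitate {F : Finset ε} {p : ν × ν}
    (hp : S.VP F p) {p' : Option (ν × ν)} {L : Finset ε} (hL : L ∈ S.KE (F, p'))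
    (h : S.bE F (some p) = S.fl F (S.cc F p.1) L.val) : False := by
  have h1 := congrArg Multiset.card h
  rw [card_bE_some] at h1
  by_cases hb : p.2 = S.o
  · rw [if_pos hb, hp.co.1 hb, fl_KE_zero hL RR_avoid_o] at h1
    simp at h1
  · rw [if_neg hb] at h1
    have := fl_KE_le hL (S.cc F p.1)
    simp only at this
    omega

theorem fl_add (F : Finset ε) (q : Cmp S.ends (insert S.z F)) (μ τ : Multiset ε) :
    S.fl F q (μ + τ) = S.fl F q μ + S.fl F q τ := Multiset.filter_add _ _ _

theorem E1_inj {i j : Finset ε × Option (ν × ν)} (hi : i ∈ S.Idx) (hj : j ∈ S.Idx)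
    {K L : Finset ε} (hK : K ∈ S.KE i) (hL : L ∈ S.KE j) (h : S.E1 i K = S.E1 j L) :
    i = j ∧ K = L := by
  obtain ⟨F, p⟩ := i
  obtain ⟨F', p'⟩ := j
  obtain ⟨h1, h2, h3⟩ := mem_idx.1 hi
  obtain ⟨h1', h2', h3'⟩ := mem_idx.1 hj
  simp only at h1 h2 h3 h1' h2' h3'
  have hFF : F = F' := by
    have hs : ∀ e ∈ K.val + S.bE F p, e ∈ F := by
      intro e he
      rcases Multiset.mem_add.1 he with he | he
      · exact mem_KE hK he
      · exact bE_mem h1 h2 h3 e he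
    have hs' : ∀ e ∈ L.val + S.bE F' p', e ∈ F' := by
      intro e he
      rcases Multiset.mem_add.1 he with he | he
      · exact mem_KE hL he
      · exact bE_mem h1' h2' h3' e he
    rw [← del_toFinset hs, ← del_toFinset hs']
    exact congrArg Multiset.toFinset h
  subst hFF
  have heq : K.val + S.bE F p = L.val + S.bE F p' := (add_right_inj _).1 h
  have hfl : ∀ q, S.fl F q K.val + S.fl F q (S.bE F p) =
      S.fl F q L.val + S.fl F q (S.bE F p') := by
    intro q
    rw [← fl_add, ← fl_add, heq]
  cases p with
  | none =>
    cases p' with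
    | none =>
      simp only [bE, add_zero, Finset.val_inj] at heq
      exact ⟨rfl, heq⟩
    | some p' =>
      exfalso
      have hv' := h3' p' rfl
      have hq := hfl (S.cc F p'.1)
      rw [fl_bE h1 h2 hv', fl_KE_zero hL RR_avoid_p] at hq
      simp only [bE, fl, Multiset.filter_zero, add_zero, zero_add] at hq
      exact no_imitate hv' hK hq.symm
  | some p =>
    have hv := h3 p rfl
    have hq := hfl (S.cc F p.1)
    rw [fl_bE h1 h2 hv, fl_KE_zero hK RR_avoid_p, zero_add] at hq
    cases p' with
    | none =>
      exfalso
      simp only [bE, fl, Multiset.filter_zero, add_zero] at hq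
      exact no_imitate hv hL hq
    | some p' =>
      have hv' := h3' p' rfl
      have hcc : S.cc F p'.1 = S.cc F p.1 := by
        by_contra hne
        rw [fl_bE_ne h1 h2 hv' hne, add_zero] at hq
        exact no_imitate hv hL hq
      rw [← hcc, fl_bE h1 h2 hv', fl_KE_zero hL RR_avoid_p, zero_add] at hq
      have hKL : K = L := by
        rw [hq] at heq
        exact Finset.val_inj.1 ((add_left_inj _).1 heq)
      subst hKL
      have hbb : p.2 = S.o ↔ p'.2 = S.o := by rw [hv.co, hv'.co, hcc]
      suffices hpp : p = p' by
        subst hpp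
        exact ⟨rfl, rfl⟩
      have f1 := hv.phi1 h1 h2
      have f2 := hv.phi2 h1 h2
      have f1' := hv'.phi1 h1 h2
      have f2' := hv'.phi2 h1 h2
      simp only [bE] at hq
      by_cases hb : p.2 = S.o
      · have hb' := hbb.1 hb
        rw [if_pos hb, if_pos hb', Multiset.singleton_inj] at hq
        rw [← hq] at f1'
        refine Prod.ext (First.eq_of_same f1 f1' ?_) (hb.trans hb'.symm)
        rw [hb, hb']
        exact Reachable.refl _ _
      · rw [if_neg hb, if_neg (fun h => hb (hbb.2 h))] at hq
        have hq2 : (S.phi F p.1 p.2 = S.phi F p'.1 p'.2 ∧ S.phi F p.2 p.1 = S.phi F p'.2 p'.1) ∨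
            (S.phi F p.1 p.2 = S.phi F p'.2 p'.1 ∧ S.phi F p.2 p.1 = S.phi F p'.1 p'.2) := by
          simp only [Multiset.insert_eq_cons] at hq
          rcases Multiset.cons_eq_cons.1 hq with ⟨g1, g2⟩ | ⟨_, cs, g1, g2⟩
          · exact Or.inl ⟨g1, Multiset.singleton_inj.1 g2⟩
          · right
            have hc : cs = 0 := by
              have := congrArg Multiset.card g1
              simpa using this
            subst hc
            exact ⟨(Multiset.singleton_inj.1 g2).symm, Multiset.singleton_inj.1 g1⟩
        obtain ⟨g1, g2⟩ := First.pair_inj hv.1 hv.2.1 hv'.1 hv'.2.1 f1 f2 f1' f2' hq2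
        exact Prod.ext g1 g2

theorem card_E1 {i : Finset ε × Option (ν × ν)} (hi : i ∈ S.Idx) {K : Finset ε}
    {d : ℕ} (hd : d + 1 = Fintype.card ν) (hK : K ∈ S.KE i) :
    Multiset.card (S.E1 i K) ≤ d ∧
      d - Multiset.card (S.E1 i K) = (S.RR i.1 i.2).card - K.card + dl i.2 := by
  have h1 := card_RR hi
  have h2 := card_le_of_mem_trans hK
  have h3 := card_bE (mem_idx.1 hi).2.2
  have h4 : Multiset.card (S.E1 i K) = i.1.card + (K.card + (S.base i.2).card) := by
    simp only [E1, Multiset.card_add, Finset.card_val, h3]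
  omega

variable (S) in
/-- The members of the multicomplex as a finite set. -/
def MF : Finset (Multiset ε) :=
  (S.Idx.sigma S.KE).image fun x => S.E1 x.1 x.2

theorem mem_MF {μ : Multiset ε} : μ ∈ S.MF ↔ S.MC μ := by
  simp only [MF, Finset.mem_image, Finset.mem_sigma]
  constructor
  · rintro ⟨⟨i, K⟩, ⟨hi, hK⟩, rfl⟩
    exact E1_mem hi hK
  · intro h
    obtain ⟨i, hi, K, hK, rfl⟩ := E1_surj h
    exact ⟨⟨i, K⟩, ⟨hi, hK⟩, rfl⟩

theorem MC_card {μ : Multiset ε} {d : ℕ} (hd : d + 1 = Fintype.card ν) (h : S.MC μ) :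
    Multiset.card μ ≤ d := by
  obtain ⟨i, hi, K, hK, rfl⟩ := E1_surj h
  exact (card_E1 hi hd hK).1

theorem sum_MF {R : Type} [CommSemiring R] (t : R) {d : ℕ} (hd : d + 1 = Fintype.card ν) :
    ∑ A ∈ Finset.univ.filter (fun A => IsAcyclic S.ends A), t ^ (d - A.card) =
      ∑ μ ∈ S.MF, (t + 1) ^ (d - Multiset.card μ) := by
  rw [sum_acyclic t hd, MF, Finset.sum_image, Finset.sum_sigma]
  · refine Finset.sum_congr rfl fun i hi => Finset.sum_congr rfl fun K hK => ?_
    rw [(card_E1 hi hd hK).2]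
  · rintro ⟨i, K⟩ hx ⟨j, L⟩ hy h
    rw [Finset.mem_coe, Finset.mem_sigma] at hx hy
    obtain ⟨rfl, rfl⟩ := E1_inj hx.1 hy.1 hx.2 hy.2 h
    rfl

theorem MC_of_le {μ τ : Multiset ε} (h : S.MC μ) (hle : τ ≤ μ) : S.MC τ :=
  Del.of_le h (Multiset.cons_le_cons _ (Multiset.cons_le_cons _ hle))

theorem MC_zero : S.MC 0 := by
  have h : (∅, none) ∈ S.Idx := mem_idx.2 ⟨by simp, isAcyclic_empty, by simp⟩
  have h2 : ∅ ∈ S.KE (∅, none) := by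
    rw [KE, mem_trans]
    exact ⟨by simp, by simp [Set.InjOn], by simp⟩
  exact MC_of_le (E1_mem h h2) (Multiset.zero_le _)

theorem MC_pure {μ τ : Multiset ε} (hμ : S.MC μ) (hτ : S.MC τ)
    (hm : ∀ u, S.MC u → μ ≤ u → u = μ) (hm' : ∀ u, S.MC u → τ ≤ u → u = τ) :
    Multiset.card μ = Multiset.card τ := by
  have key : ∀ μ, S.MC μ → (∀ u, S.MC u → μ ≤ u → u = μ) → ∀ ρ,
      Del S.ends S.side (insert S.z S.X) ρ → S.z ::ₘ S.z ::ₘ μ ≤ ρ → ρ = S.z ::ₘ S.z ::ₘ μ := by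
    intro μ hμ hm ρ hρ hle
    obtain ⟨σ, rfl⟩ := Multiset.le_iff_exists_add.1 hle
    simp only [Multiset.cons_add] at hρ ⊢
    rw [hm (μ + σ) hρ (Multiset.le_add_right _ _)]
  have h1 := Del.card_of_maximal hμ (key μ hμ hm)
  have h2 := Del.card_of_maximal hτ (key τ hτ hm')
  simp only [Multiset.card_cons] at h1 h2
  omega

end Setup

namespace BiconedGraph
variable (P : BiconedGraph)

theorem vert_cases (v : P.W) : v = ⊥ ∨ v = P.liftW ⊥ ∨
    (∃ a, v = P.liftW (P.liftV (P.aVert a))) ∨ ∃ b, v = P.liftW (P.liftV (P.bVert b)) := by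
  induction v using WithBot.recBotCoe with
  | bot => exact Or.inl rfl
  | coe v =>
    right
    induction v using WithBot.recBotCoe with
    | bot => exact Or.inl rfl
    | coe v =>
      right
      obtain ⟨x, rfl⟩ := toLex.surjective v
      cases x with
      | inl a => exact Or.inl ⟨a, rfl⟩
      | inr b => exact Or.inr ⟨b, rfl⟩

/-- Sides of the vertices. -/
def sideW : P.W → Bool := WithBot.recBotCoe false P.side

/-- The coning edge of a vertex. -/
def tW : P.W → P.EB :=
  WithBot.recBotCoe P.e00 (WithBot.recBotCoe P.e00
    fun x => Sum.elim (fun a => P.eA a) (fun b => P.eB b) (ofLex x))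

/-- The edges outside the tree. -/
def XW : Finset P.EB := Finset.univ.filter fun e => ∃ f : P.Ered, P.redToEB f = e

theorem lift_ne_bot (x : P.Vred) : P.liftW x ≠ ⊥ := WithBot.coe_ne_bot

theorem liftV_ne (x : P.VG) : P.liftW (P.liftV x) ≠ P.liftW ⊥ := by
  intro h
  exact WithBot.coe_ne_bot (WithBot.coe_injective h)

theorem tW_a (a : Fin P.m) : P.tW (P.liftW (P.liftV (P.aVert a))) = P.eA a := rfl
theorem tW_b (b : Fin P.n) : P.tW (P.liftW (P.liftV (P.bVert b))) = P.eB b := rfl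
theorem sideW_a (a : Fin P.m) : P.sideW (P.liftW (P.liftV (P.aVert a))) = true := rfl
theorem sideW_b (b : Fin P.n) : P.sideW (P.liftW (P.liftV (P.bVert b))) = false := rfl

/-- The setup of a biconed graph. -/
def setup : Setup P.EB P.W where
  ends := P.endsB
  side := P.sideW
  o := ⊥
  o' := P.liftW ⊥
  z := P.e00
  t := P.tW
  X := P.XW
  hz := rfl
  hoo := (P.lift_ne_bot _).symm
  so := rfl
  so' := rfl
  zX := by
    simp only [XW, Finset.mem_filter, Finset.mem_univ, true_and, not_exists]
    rintro (a | e) h <;> simp [redToEB] at h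
  hX := by
    simp only [XW, Finset.mem_filter, Finset.mem_univ, true_and]
    rintro _ ⟨a | e, rfl⟩ h
    · rcases Sym2.mem_iff.1 h with h | h
      · exact P.lift_ne_bot _ h.symm
      · exact P.lift_ne_bot _ h.symm
    · obtain ⟨x, _, hx⟩ := Sym2.mem_map.1 h
      exact P.lift_ne_bot _ hx
  ht := by
    intro v h1 h2
    rcases P.vert_cases v with rfl | rfl | ⟨a, rfl⟩ | ⟨b, rfl⟩
    · exact absurd rfl h1
    · exact absurd rfl h2
    · rw [tW_a, sideW_a, if_pos rfl]
      rfl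
    · rw [tW_b, sideW_b, if_neg (by simp)]
      rfl
  tX := by
    intro v h1 h2
    simp only [XW, Finset.mem_filter, Finset.mem_univ, true_and, not_exists]
    rcases P.vert_cases v with rfl | rfl | ⟨a, rfl⟩ | ⟨b, rfl⟩
    · exact absurd rfl h1
    · exact absurd rfl h2
    · rw [tW_a]
      rintro (c | e) h <;> simp [redToEB] at h
    · rw [tW_b]
      rintro (c | e) h <;> simp [redToEB] at h
  tz := by
    intro v h1 h2
    rcases P.vert_cases v with rfl | rfl | ⟨a, rfl⟩ | ⟨b, rfl⟩
    · exact absurd rfl h1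
    · exact absurd rfl h2
    · rw [tW_a]; simp
    · rw [tW_b]; simp
  tinj := by
    intro v h1 h2 w h3 h4 h
    rcases P.vert_cases v with rfl | rfl | ⟨a, rfl⟩ | ⟨b, rfl⟩
    · exact absurd rfl h1
    · exact absurd rfl h2
    · rcases P.vert_cases w with rfl | rfl | ⟨c, rfl⟩ | ⟨c, rfl⟩
      · exact absurd rfl h3
      · exact absurd rfl h4
      · rw [tW_a, tW_a] at h
        simp at h
        rw [h]
      · rw [tW_a, tW_b] at h
        simp at h
    · rcases P.vert_cases w with rfl | rfl | ⟨c, rfl⟩ | ⟨c, rfl⟩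
      · exact absurd rfl h3
      · exact absurd rfl h4
      · rw [tW_a, tW_b] at h
        simp at h
      · rw [tW_b, tW_b] at h
        simp at h
        rw [h]
  cover := by
    rintro (u | a | b | a | e)
    · exact Or.inl rfl
    · exact Or.inr (Or.inr ⟨P.liftW (P.liftV (P.aVert a)), P.lift_ne_bot _, P.liftV_ne _, rfl⟩)
    · exact Or.inr (Or.inr ⟨P.liftW (P.liftV (P.bVert b)), P.lift_ne_bot _, P.liftV_ne _, rfl⟩)
    · right; left
      simp only [XW, Finset.mem_filter, Finset.mem_univ, true_and]
      exact ⟨Sum.inl a, rfl⟩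
    · right; left
      simp only [XW, Finset.mem_filter, Finset.mem_univ, true_and]
      exact ⟨Sum.inr e, rfl⟩

theorem card_W : P.d + 1 = Fintype.card P.W := by
  have h : Fintype.card P.VG = P.m + P.n := by
    rw [Fintype.card_congr (ofLex (α := Fin P.m ⊕ Fin P.n))]
    simp
  have e : P.W ≃ Option (Option P.VG) := Equiv.refl _
  have h2 : Fintype.card P.W = Fintype.card (Option (Option P.VG)) := Fintype.card_congr e
  rw [h2, Fintype.card_option, Fintype.card_option, h]
  rfl

end BiconedGraph

theorem sum_by_card {α : Type} (s : Finset α) (g : α → ℕ) (d : ℕ) (hg : ∀ a ∈ s, g a ≤ d)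
    (y : Polynomial ℤ) : ∑ a ∈ s, y ^ (d - g a) =
      ∑ i ∈ Finset.range (d + 1),
        Polynomial.C (((s.filter fun a => g a = i).card : ℕ) : ℤ) * y ^ (d - i) := by
  rw [← Finset.sum_fiberwise_of_maps_to (t := Finset.range (d + 1)) (g := g)]
  · refine Finset.sum_congr rfl fun i _ => ?_
    rw [Finset.sum_congr rfl (g := fun _ => y ^ (d - i))]
    · simp
    · intro a ha
      rw [(Finset.mem_filter.1 ha).2]
  · intro a ha
    rw [Finset.mem_range]
    exact Nat.lt_succ_of_le (hg a ha)

theorem coeff_compare {d : ℕ} {c h : ℕ → ℤ}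
    (heq : ∑ k ∈ Finset.range (d + 1), Polynomial.C (c k) * Polynomial.X ^ (d - k) =
      ∑ k ∈ Finset.range (d + 1), Polynomial.C (h k) * Polynomial.X ^ (d - k)) :
    ∀ i ≤ d, c i = h i := by
  intro i hi
  have key : ∀ c : ℕ → ℤ, (∑ k ∈ Finset.range (d + 1),
      Polynomial.C (c k) * Polynomial.X ^ (d - k)).coeff (d - i) = c i := by
    intro c
    rw [Polynomial.finsetSum_coeff, Finset.sum_eq_single i]
    · simp
    · intro k hk hki
      rw [Finset.mem_range] at hk
      rw [Polynomial.coeff_C_mul_X_pow, if_neg]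
      omega
    · intro hh
      exact absurd (Finset.mem_range.2 (by omega)) hh
  rw [← key c, ← key h, heq]

theorem hvector_eq (P : BiconedGraph) (h : ℕ → ℤ) (hh : P.IsHVector h) :
    ∀ i ≤ P.d, (((P.setup.MF.filter fun μ => Multiset.card μ = i).card : ℕ) : ℤ) = h i := by
  have hd := P.card_W
  apply coeff_compare
  rw [← hh, ← sum_by_card _ _ _ (fun μ hμ => Setup.MC_card hd (Setup.mem_MF.1 hμ))]
  have h1 := Setup.sum_MF (S := P.setup) (Polynomial.X - 1 : Polynomial ℤ) hd
  rw [sub_add_cancel] at h1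
  rw [← h1, sum_by_card]
  · refine Finset.sum_congr rfl fun i _ => ?_
    congr 3
    rw [BiconedGraph.numAcyclic, Nat.card_eq_fintype_card, Fintype.card_subtype, Finset.filter_filter]
    rfl
  · intro A hA
    have h2 := card_forest (Finset.mem_filter.1 hA).2
    have h3 : 0 < Fintype.card (Cmp P.setup.ends A) :=
      Fintype.card_pos_iff.2 ⟨cq P.setup.ends A ⊥⟩
    omega

theorem stanley_main (P : BiconedGraph)
    (h : ℕ → ℤ) (hh : P.IsHVector h) :
    IsPureOSeq P.d h := by
  have hd := P.card_W
  let φ := Fintype.equivFin P.EB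
  have hinv : ∀ s, (Multiset.map φ s).map φ.symm = s := by intro s; simp
  have hinv' : ∀ s, (Multiset.map φ.symm s).map φ = s := by intro s; simp
  refine ⟨Fintype.card P.EB, {s | P.setup.MC (s.map φ.symm)}, ⟨0, ?_⟩, ?_, ?_, ?_, ?_⟩
  · simpa using Setup.MC_zero (S := P.setup)
  · intro s hs t hts
    exact Setup.MC_of_le hs (Multiset.map_le_map hts)
  · intro s hs t ht hms hmt
    have hmax : ∀ s : Multiset (Fin (Fintype.card P.EB)),
        (∀ u ∈ {s : Multiset _ | P.setup.MC (s.map φ.symm)}, s ≤ u → u = s) →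
        ∀ u, P.setup.MC u → s.map φ.symm ≤ u → u = s.map φ.symm := by
      intro s hs u hu hle
      have h1 := hs (u.map φ) (by rw [Set.mem_ofPred_eq, hinv]; exact hu)
        (by rw [← hinv' s]; exact Multiset.map_le_map hle)
      rw [← h1, hinv]
    have := Setup.MC_pure hs ht (hmax s hms) (hmax t hmt)
    simpa using this
  · intro s hs
    simpa using Setup.MC_card hd hs
  · intro i hi
    rw [← hvector_eq P h hh i hi]
    congr 1
    rw [← Nat.card_eq_finsetCard]
    refine Nat.card_congr
      { toFun := fun s => ⟨s.1.map φ.symm, ?_⟩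
        invFun := fun s => ⟨s.1.map φ, ?_⟩
        left_inv := fun s => Subtype.ext (hinv' _)
        right_inv := fun s => Subtype.ext (hinv _) }
    · rw [Finset.mem_filter, Setup.mem_MF, Multiset.card_map]
      exact s.2
    · have := s.2
      rw [Finset.mem_filter, Setup.mem_MF] at this
      rw [Set.mem_ofPred_eq, hinv, Multiset.card_map]
      exact this

/-- Corollary 4.5; Stanley's conjecture for biconed graphs.
For any biconed graph `G^{A,B}`, the h-vector of the graphic matroid of
`G^{A,B}` is a pure O-sequence. -/
theorem stanley_conjecture_biconed (P : BiconedGraph)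
    (h : ℕ → ℤ) (hh : P.IsHVector h) :
    IsPureOSeq P.d h := by
  exact stanley_main P h hh

end

end BiconedPaper
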